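/- Let r be a nonnegative integer, M ⊆ ℝⁿ a definable C^r submanifold, and X, Y definable subsets of M that are closed in M and satisfy X ∩ Y = ∅. Then there exists a definable C^r function f: M → [0,1] with f⁻¹(0) = X and f⁻¹(1) = Y. -/

import Mathlib

open FirstOrder Set Topology

namespace Paper

variable (L : FirstOrder.Language) [L.Structure ℝ]

/-- A subset of `ℝⁿ` is definable in the structure (with parameters from `ℝ`). -/
def Def (n : ℕ) (s : Set (Fin n → ℝ)) : Prop :=
  Set.Definable (Set.univ : Set ℝ) L s

/-- A subset of `ℝ` is definable. -/
def Def1 (s : Set ℝ) : Prop := Def L 1 {x | x 0 ∈ s}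

/-- The structure expands the ordered field `(ℝ, <, +, ·, 0, 1)`:
the order and the field operations (and the constants) are definable. -/
def ExpandsOrderedField : Prop :=
  Def L 2 {x | x 0 < x 1} ∧ Def L 3 {x | x 0 + x 1 = x 2} ∧
  Def L 3 {x | x 0 * x 1 = x 2} ∧ Def L 1 {x | x 0 = 0} ∧ Def L 1 {x | x 0 = 1}

/-- Local o-minimality: every definable subset of `ℝ` is, near each point, a finite
union of points and open intervals. -/
def LocallyOMinimal : Prop :=
  ∀ X : Set ℝ, Def1 L X → ∀ a : ℝ,
    ∃ b c : ℝ, b < a ∧ a < c ∧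
      ∃ (P : Finset ℝ) (J : Finset (ℝ × ℝ)),
        X ∩ Set.Ioo b c = ↑P ∪ ⋃ p ∈ J, Set.Ioo p.1 p.2

/-- First component of a point of `ℝ^(m+n) = ℝ^m × ℝ^n`. -/
def fstFun {m n : ℕ} (z : Fin (m + n) → ℝ) : Fin m → ℝ := fun i => z (Fin.castAdd n i)

/-- Second component of a point of `ℝ^(m+n) = ℝ^m × ℝ^n`. -/
def sndFun {m n : ℕ} (z : Fin (m + n) → ℝ) : Fin n → ℝ := fun j => z (Fin.natAdd m j)

/-- The map `f : X → ℝⁿ`, `X ⊆ ℝ^m`, is definable (its graph over `X` is definable). -/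
def DefMapOn (m n : ℕ) (X : Set (Fin m → ℝ)) (f : (Fin m → ℝ) → (Fin n → ℝ)) : Prop :=
  Def L (m + n) {z | fstFun z ∈ X ∧ sndFun z = f (fstFun z)}

/-- The function `f : X → ℝ`, `X ⊆ ℝ^m`, is definable. -/
def DefFunOn (m : ℕ) (X : Set (Fin m → ℝ)) (f : (Fin m → ℝ) → ℝ) : Prop :=
  DefMapOn L m 1 X fun x _ => f x

/-- `f` is of class `C^r` on `X` in the sense that near every point of `X` it agrees on `X`
with a `C^r` map defined on an open neighborhood in the ambient space. -/
def CrMapOn (r m n : ℕ) (X : Set (Fin m → ℝ)) (f : (Fin m → ℝ) → (Fin n → ℝ)) : Prop :=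
  ∀ a ∈ X, ∃ (W : Set (Fin m → ℝ)) (g : (Fin m → ℝ) → (Fin n → ℝ)),
    a ∈ W ∧ IsOpen W ∧ ContDiffOn ℝ r g W ∧ Set.EqOn f g (X ∩ W)

/-- Real-valued version of `CrMapOn`. -/
def CrFunOn (r m : ℕ) (X : Set (Fin m → ℝ)) (f : (Fin m → ℝ) → ℝ) : Prop :=
  ∀ a ∈ X, ∃ (W : Set (Fin m → ℝ)) (g : (Fin m → ℝ) → ℝ),
    a ∈ W ∧ IsOpen W ∧ ContDiffOn ℝ r g W ∧ Set.EqOn f g (X ∩ W)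

/-- A definable `C^r` map `X → ℝⁿ`. -/
def DefCrMapOn (r m n : ℕ) (X : Set (Fin m → ℝ)) (f : (Fin m → ℝ) → (Fin n → ℝ)) : Prop :=
  DefMapOn L m n X f ∧ CrMapOn r m n X f

/-- A definable `C^r` function `X → ℝ`. -/
def DefCrFunOn (r m : ℕ) (X : Set (Fin m → ℝ)) (f : (Fin m → ℝ) → ℝ) : Prop :=
  DefFunOn L m X f ∧ CrFunOn r m X f

/-- A definable `C^r` submanifold of `ℝⁿ` of dimension `d`: around every point there is a
definable `C^r` chart of `ℝⁿ` straightening `M` to the first `d` coordinates. -/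
def IsDefCrSubmanifold (r n d : ℕ) (M : Set (Fin n → ℝ)) : Prop :=
  Def L n M ∧
  ∀ a ∈ M, ∃ (U V : Set (Fin n → ℝ)) (φ ψ : (Fin n → ℝ) → (Fin n → ℝ)),
    a ∈ U ∧ IsOpen U ∧ Def L n U ∧
    (0 : Fin n → ℝ) ∈ V ∧ IsOpen V ∧ Def L n V ∧
    DefMapOn L n n U φ ∧ DefMapOn L n n V ψ ∧
    ContDiffOn ℝ r φ U ∧ ContDiffOn ℝ r ψ V ∧
    Set.BijOn φ U V ∧ Set.InvOn ψ φ U V ∧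
    φ a = 0 ∧
    φ '' (M ∩ U) = {x ∈ V | ∀ i : Fin n, d ≤ (i : ℕ) → x i = 0}

/-- The Euclidean norm on `ℝⁿ`. -/
noncomputable def eunorm {n : ℕ} (x : Fin n → ℝ) : ℝ := Real.sqrt (∑ i, x i ^ 2)

/-- Projection of `ℝⁿ` onto the `d` coordinates selected by `σ`. -/
def coordProj {n : ℕ} (d : ℕ) (σ : Fin d → Fin n) (x : Fin n → ℝ) : Fin d → ℝ :=
  fun i => x (σ i)

/-- `X ⊆ ℝⁿ` has dimension `d`: `d` is the largest integer such that some coordinate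
projection of `X` onto `ℝ^d` has nonempty interior. -/
def HasDim {n : ℕ} (X : Set (Fin n → ℝ)) (d : ℕ) : Prop :=
  (∃ σ : Fin d → Fin n, Function.Injective σ ∧ (interior (coordProj d σ '' X)).Nonempty) ∧
  ∀ (e : ℕ) (σ : Fin e → Fin n), Function.Injective σ →
    (interior (coordProj e σ '' X)).Nonempty → e ≤ d

/-- A (bounded) open box in `ℝⁿ`. -/
def IsOpenBox {n : ℕ} (B : Set (Fin n → ℝ)) : Prop :=
  ∃ a b : Fin n → ℝ, (∀ i, a i < b i) ∧ B = Set.pi Set.univ fun i => Set.Ioo (a i) (b i)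

section Calculus

/-- A space with a notion of definable parametrization by tuples of real numbers. -/
class DSpace (L : FirstOrder.Language) [L.Structure ℝ] (X : Type) where
  plot : ∀ {ι : Type} [Finite ι], ((ι → ℝ) → X) → Prop
  plot_const : ∀ {ι : Type} [Finite ι] (x : X), plot (fun _ : ι → ℝ => x)
  plot_comp : ∀ {ι κ : Type} [Finite ι] [Finite κ] {c : (ι → ℝ) → X}, plot c →
    ∀ h : (κ → ℝ) → (ι → ℝ), (∀ i, (univ : Set ℝ).DefinableFun L fun v => h v i) →
      plot fun v => c (h v)

instance : DSpace L ℝ where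
  plot c := (univ : Set ℝ).DefinableFun L c
  plot_const x := FirstOrder.Language.definableFun_const L _ (mem_univ x)
  plot_comp hc _ hh := Set.DefinableFun.comp hh hc

instance : DSpace L Prop where
  plot c := (univ : Set ℝ).Definable L {v | c v}
  plot_const x := by
    by_cases h : x
    · simp [h, Set.definable_univ]
    · simp [h, Set.definable_empty]
  plot_comp hc _ hh := Set.Definable.preimage_map hh hc

instance {X Y : Type} [DSpace L X] [DSpace L Y] : DSpace L (X × Y) where
  plot c := DSpace.plot L (fun v => (c v).1) ∧ DSpace.plot L (fun v => (c v).2)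
  plot_const x := ⟨DSpace.plot_const x.1, DSpace.plot_const x.2⟩
  plot_comp hc h hh := ⟨DSpace.plot_comp hc.1 h hh, DSpace.plot_comp hc.2 h hh⟩

instance {X I : Type} [DSpace L X] : DSpace L (I → X) where
  plot c := ∀ i, DSpace.plot L (fun v => c v i)
  plot_const x i := DSpace.plot_const (x i)
  plot_comp hc h hh i := DSpace.plot_comp (hc i) h hh

/-- Definable maps (with parameters). For `Y = Prop` these are the definable predicates. -/
@[fun_prop]
def Dfn {X Y : Type} [DSpace L X] [DSpace L Y] (f : X → Y) : Prop :=
  ∀ ⦃ι : Type⦄ [Finite ι] (c : (ι → ℝ) → X), DSpace.plot L c → DSpace.plot L fun v => f (c v)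

/-- The structure expands the real field and is locally o-minimal. -/
class Tame : Prop where
  field : ExpandsOrderedField L
  lom : LocallyOMinimal L

variable {L}
variable {X Y Z : Type} [DSpace L X] [DSpace L Y] [DSpace L Z]

@[fun_prop] theorem Dfn.id' : Dfn L (fun x : X => x) := fun _ _ _ h => h

@[fun_prop] theorem Dfn.const' (y : Y) : Dfn L (fun _ : X => y) :=
  fun _ _ _ _ => DSpace.plot_const y

@[fun_prop] theorem Dfn.comp' {g : Y → Z} {f : X → Y} (hg : Dfn L g) (hf : Dfn L f) :
    Dfn L (fun x => g (f x)) := fun _ _ c hc => hg _ (hf c hc)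

@[fun_prop] theorem Dfn.prodMk {f : X → Y} {g : X → Z} (hf : Dfn L f) (hg : Dfn L g) :
    Dfn L (fun x => (f x, g x)) := fun _ _ c hc => ⟨hf c hc, hg c hc⟩

@[fun_prop] theorem Dfn.fst' {f : X → Y × Z} (hf : Dfn L f) : Dfn L (fun x => (f x).1) :=
  fun _ _ c hc => (hf c hc).1

@[fun_prop] theorem Dfn.snd' {f : X → Y × Z} (hf : Dfn L f) : Dfn L (fun x => (f x).2) :=
  fun _ _ c hc => (hf c hc).2

@[fun_prop] theorem Dfn.pi' {I : Type} {f : X → I → Y} (hf : ∀ i, Dfn L (fun x => f x i)) :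
    Dfn L (fun x i => f x i) := fun _ _ c hc i => hf i c hc

@[fun_prop] theorem Dfn.apply' {I : Type} (i : I) : Dfn L (fun f : I → Y => f i) :=
  fun _ _ _ hc => hc i

theorem dfn_pi_iff {I : Type} {f : X → I → Y} : Dfn L f ↔ ∀ i, Dfn L (fun x => f x i) :=
  ⟨fun h i _ _ c hc => h c hc i, Dfn.pi'⟩

theorem plot_iff_dfn {ι : Type} [Finite ι] {f : (ι → ℝ) → Y} : DSpace.plot L f ↔ Dfn L f := by
  refine ⟨fun h κ _ c hc => DSpace.plot_comp h c hc, fun h => ?_⟩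
  exact h (fun v => v) fun i => Set.DefinableFun.proj L

theorem dfn_iff_def {n : ℕ} {p : (Fin n → ℝ) → Prop} : Dfn L p ↔ Def L n {x | p x} :=
  plot_iff_dfn.symm

@[fun_prop] theorem Dfn.and {p q : X → Prop} (hp : Dfn L p) (hq : Dfn L q) :
    Dfn L (fun x => p x ∧ q x) := fun _ _ c hc => Set.Definable.inter (hp c hc) (hq c hc)

@[fun_prop] theorem Dfn.or {p q : X → Prop} (hp : Dfn L p) (hq : Dfn L q) :
    Dfn L (fun x => p x ∨ q x) := fun _ _ c hc => Set.Definable.union (hp c hc) (hq c hc)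

@[fun_prop] theorem Dfn.not {p : X → Prop} (hp : Dfn L p) :
    Dfn L (fun x => ¬ p x) := fun _ _ c hc => Set.Definable.compl (hp c hc)

@[fun_prop] theorem Dfn.imp {p q : X → Prop} (hp : Dfn L p) (hq : Dfn L q) :
    Dfn L (fun x => p x → q x) := by
  simp only [imp_iff_not_or]; exact hp.not.or hq

@[fun_prop] theorem Dfn.iff {p q : X → Prop} (hp : Dfn L p) (hq : Dfn L q) :
    Dfn L (fun x => p x ↔ q x) := by
  simp only [iff_iff_implies_and_implies]; exact (hp.imp hq).and (hq.imp hp)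

theorem Dfn.exists_pi {I : Type} [Finite I] {p : X → (I → ℝ) → Prop}
    (hp : Dfn L (fun q : X × (I → ℝ) => p q.1 q.2)) : Dfn L (fun x => ∃ y, p x y) := by
  intro ι _ c hc
  have h := hp (fun v : ι ⊕ I → ℝ => (c (fun i => v (Sum.inl i)), fun i => v (Sum.inr i)))
    ⟨DSpace.plot_comp hc _ fun i => Set.DefinableFun.proj L, fun i => Set.DefinableFun.proj L⟩
  exact Set.Definable.exists_of_finite h

theorem Dfn.exists_real {p : X → ℝ → Prop}
    (hp : Dfn L (fun q : X × ℝ => p q.1 q.2)) : Dfn L (fun x => ∃ y, p x y) := by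
  have h := Dfn.exists_pi (I := Unit) (p := fun (x : X) (w : Unit → ℝ) => p x (w ())) (L := L)
    (hp.comp' (f := fun q : X × (Unit → ℝ) => (q.1, q.2 ())) (by fun_prop))
  convert h using 2 with x
  exact ⟨fun ⟨y, hy⟩ => ⟨fun _ => y, hy⟩, fun ⟨w, hw⟩ => ⟨_, hw⟩⟩

variable (L) in
/-- Spaces over which one may quantify definably. -/
class Quantifiable (Y : Type) [DSpace L Y] : Prop where
  ex : ∀ {ι : Type} [Finite ι] {p : (ι → ℝ) → Y → Prop},
    Dfn L (fun q : (ι → ℝ) × Y => p q.1 q.2) → Dfn L (fun x => ∃ y, p x y)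

instance : Quantifiable L ℝ := ⟨Dfn.exists_real⟩

instance {I : Type} [Finite I] : Quantifiable L (I → ℝ) := ⟨Dfn.exists_pi⟩

@[fun_prop] theorem Dfn.exists [Quantifiable L Y] {p : X → Y → Prop}
    (hp : Dfn L (fun q : X × Y => p q.1 q.2)) : Dfn L (fun x => ∃ y, p x y) := by
  intro ι _ c hc
  refine plot_iff_dfn.2 (Quantifiable.ex ?_)
  have := plot_iff_dfn.1 hc
  exact hp.comp' (f := fun q : (ι → ℝ) × Y => (c q.1, q.2)) (by fun_prop)

@[fun_prop] theorem Dfn.forall [Quantifiable L Y] {p : X → Y → Prop}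
    (hp : Dfn L (fun q : X × Y => p q.1 q.2)) : Dfn L (fun x => ∀ y, p x y) := by
  have := (Dfn.exists (p := fun x y => ¬ p x y) hp.not).not
  simpa using this

@[fun_prop] theorem Dfn.forall_finite {I : Type} [Finite I] {p : X → I → Prop}
    (hp : ∀ i, Dfn L (fun x => p x i)) : Dfn L (fun x => ∀ i, p x i) := by
  intro ι _ c hc
  have := Set.definable_iInter_of_finite fun i => hp i c hc
  simpa [DSpace.plot, Set.ofPred_forall] using this

@[fun_prop] theorem Dfn.exists_finite {I : Type} [Finite I] {p : X → I → Prop}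
    (hp : ∀ i, Dfn L (fun x => p x i)) : Dfn L (fun x => ∃ i, p x i) := by
  have := (Dfn.forall_finite (p := fun x i => ¬ p x i) fun i => (hp i).not).not
  simpa using this

@[fun_prop] theorem Dfn.eq_real {f g : X → ℝ} (hf : Dfn L f) (hg : Dfn L g) :
    Dfn L (fun x => f x = g x) := fun _ _ c hc =>
  Set.DefinableFun.ofPred_eq (hf c hc) (hg c hc)

@[fun_prop] theorem Dfn.eq_pi {I : Type} [Finite I] {f g : X → I → ℝ} (hf : Dfn L f)
    (hg : Dfn L g) : Dfn L (fun x => f x = g x) := by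
  simp only [funext_iff]
  rw [dfn_pi_iff] at hf hg
  fun_prop

theorem dfn_real_iff {f : X → ℝ} : Dfn L f ↔ Dfn L (fun q : X × ℝ => f q.1 = q.2) := by
  refine ⟨fun h => by fun_prop, fun h ι _ c hc => ?_⟩
  have := h (fun v : Option ι → ℝ => (c (fun i => v (some i)), v none))
    ⟨DSpace.plot_comp hc _ fun i => Set.DefinableFun.proj L, Set.DefinableFun.proj L⟩
  exact this

/-- A real function whose graph is described by a definable predicate is definable. -/
theorem dfn_of_graph {f : X → ℝ} {p : X → ℝ → Prop} (hp : Dfn L (fun q : X × ℝ => p q.1 q.2))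
    (h : ∀ x y, f x = y ↔ p x y) : Dfn L f := by
  rw [dfn_real_iff]; simpa only [h] using hp

@[fun_prop] theorem Dfn.ite {p : X → Prop} [DecidablePred p] {f g : X → ℝ} (hp : Dfn L p)
    (hf : Dfn L f) (hg : Dfn L g) : Dfn L (fun x => if p x then f x else g x) := by
  refine dfn_of_graph (p := fun x y => (p x ∧ f x = y) ∨ (¬ p x ∧ g x = y)) (by fun_prop) ?_
  intro x y
  by_cases h : p x <;> simp [h]

section Field
variable [T : Tame L]

@[fun_prop] theorem Dfn.lt {f g : X → ℝ} (hf : Dfn L f) (hg : Dfn L g) :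
    Dfn L (fun x => f x < g x) := by
  have h := dfn_iff_def.2 T.field.1
  exact h.comp' (f := fun x => ![f x, g x]) (Dfn.pi' fun i => by fin_cases i <;> simpa)

@[fun_prop] theorem Dfn.le {f g : X → ℝ} (hf : Dfn L f) (hg : Dfn L g) :
    Dfn L (fun x => f x ≤ g x) := by
  simp only [← not_lt]; fun_prop

@[fun_prop] theorem Dfn.add {f g : X → ℝ} (hf : Dfn L f) (hg : Dfn L g) :
    Dfn L (fun x => f x + g x) := by
  have h := dfn_iff_def.2 T.field.2.1
  refine dfn_real_iff.2 (h.comp' (f := fun q : X × ℝ => ![f q.1, g q.1, q.2])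
    (Dfn.pi' fun i => ?_))
  fin_cases i <;> simp <;> fun_prop

@[fun_prop] theorem Dfn.mul {f g : X → ℝ} (hf : Dfn L f) (hg : Dfn L g) :
    Dfn L (fun x => f x * g x) := by
  have h := dfn_iff_def.2 T.field.2.2.1
  refine dfn_real_iff.2 (h.comp' (f := fun q : X × ℝ => ![f q.1, g q.1, q.2])
    (Dfn.pi' fun i => ?_))
  fin_cases i <;> simp <;> fun_prop

@[fun_prop] theorem Dfn.neg {f : X → ℝ} (hf : Dfn L f) : Dfn L (fun x => - f x) := by
  simp only [← neg_one_mul (f _)]; fun_prop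

@[fun_prop] theorem Dfn.sub {f g : X → ℝ} (hf : Dfn L f) (hg : Dfn L g) :
    Dfn L (fun x => f x - g x) := by
  simp only [sub_eq_add_neg]; fun_prop

@[fun_prop] theorem Dfn.pow {f : X → ℝ} (hf : Dfn L f) (k : ℕ) : Dfn L (fun x => f x ^ k) := by
  induction k with
  | zero => simp only [pow_zero]; fun_prop
  | succ k ih => simp only [pow_succ]; fun_prop

@[fun_prop] theorem Dfn.inv {f : X → ℝ} (hf : Dfn L f) : Dfn L (fun x => (f x)⁻¹) := by
  refine dfn_of_graph (p := fun x y => (f x = 0 ∧ y = 0) ∨ f x * y = 1) (by fun_prop) ?_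
  intro x y
  by_cases h : f x = 0
  · simp [h, eq_comm]
  · simp only [h, false_and, false_or]
    exact ⟨fun e => by rw [← e, mul_inv_cancel₀ h], fun e => inv_eq_of_mul_eq_one_right e⟩

@[fun_prop] theorem Dfn.div {f g : X → ℝ} (hf : Dfn L f) (hg : Dfn L g) :
    Dfn L (fun x => f x / g x) := by
  simp only [div_eq_mul_inv]; fun_prop

@[fun_prop] theorem Dfn.max {f g : X → ℝ} (hf : Dfn L f) (hg : Dfn L g) :
    Dfn L (fun x => max (f x) (g x)) := by
  simp only [max_def]; fun_prop

@[fun_prop] theorem Dfn.abs {f : X → ℝ} (hf : Dfn L f) : Dfn L (fun x => |f x|) := by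
  simp only [abs_eq_max_neg]; fun_prop

@[fun_prop] theorem Dfn.sum {I : Type} {s : Finset I} {f : I → X → ℝ} (hf : ∀ i, Dfn L (f i)) :
    Dfn L (fun x => ∑ i ∈ s, f i x) := by
  classical
  induction s using Finset.induction_on with
  | empty => simp only [Finset.sum_empty]; fun_prop
  | insert a s ha ih => simp only [Finset.sum_insert ha]; fun_prop

theorem isLUB_iff_of_sSup {S : Set ℝ} {y : ℝ} :
    sSup S = y ↔ IsLUB S y ∨ ((¬ ∃ z, IsLUB S z) ∧ y = 0) := by
  by_cases h : S.Nonempty ∧ BddAbove S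
  · have hl := isLUB_csSup h.1 h.2
    refine ⟨fun e => Or.inl (e ▸ hl), ?_⟩
    rintro (e | ⟨e, -⟩)
    · exact hl.unique e
    · exact absurd ⟨_, hl⟩ e
  · have h0 : sSup S = 0 := by
      rcases not_and_or.1 h with h | h
      · rw [Set.not_nonempty_iff_eq_empty.1 h, Real.sSup_empty]
      · exact Real.sSup_of_not_bddAbove h
    have h1 : ¬ ∃ z, IsLUB S z := fun ⟨z, hz⟩ => h ⟨hz.nonempty, hz.bddAbove⟩
    rw [h0]
    refine ⟨fun e => Or.inr ⟨h1, e.symm⟩, ?_⟩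
    rintro (e | ⟨-, e⟩)
    · exact absurd ⟨_, e⟩ h1
    · exact e.symm

@[fun_prop] theorem Dfn.sSup {p : X → ℝ → Prop} (hp : Dfn L (fun q : X × ℝ => p q.1 q.2)) :
    Dfn L (fun x => sSup {y | p x y}) := by
  refine dfn_of_graph (p := fun x y => IsLUB {y | p x y} y ∨
    ((¬ ∃ z, IsLUB {y | p x y} z) ∧ y = 0)) ?_ fun x y => isLUB_iff_of_sSup
  simp only [IsLUB, IsLeast, upperBounds, lowerBounds, Set.mem_ofPred_eq]
  have hp' : ∀ {V : Type} [DSpace L V] {f : V → X} {g : V → ℝ}, Dfn L f → Dfn L g →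
    Dfn L (fun v => p (f v) (g v)) := fun hf hg => hp.comp' (hf.prodMk hg)
  fun_prop (disch := assumption)

end Field

end Calculus

section OneVariable

/-- Membership in `S` is decided near `a` on the right. -/
def DecidedRight (S : Set ℝ) (a : ℝ) : Prop :=
  (∀ᶠ x in 𝓝[>] a, x ∈ S) ∨ (∀ᶠ x in 𝓝[>] a, x ∉ S)

theorem DecidedRight.union {S S' : Set ℝ} {a : ℝ} (h : DecidedRight S a)
    (h' : DecidedRight S' a) : DecidedRight (S ∪ S') a := by
  rcases h with h | h
  · exact Or.inl (h.mono fun x hx => Or.inl hx)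
  rcases h' with h' | h'
  · exact Or.inl (h'.mono fun x hx => Or.inr hx)
  · exact Or.inr ((h.and h').mono fun x hx hx' => hx'.elim hx.1 hx.2)

theorem decidedRight_finset (P : Finset ℝ) (a : ℝ) : DecidedRight (P : Set ℝ) a := by
  right
  have : (P.erase a : Set ℝ)ᶜ ∈ 𝓝 a := (P.erase a).finite_toSet.isClosed.isOpen_compl.mem_nhds
    (by simp)
  filter_upwards [mem_nhdsWithin_of_mem_nhds this, self_mem_nhdsWithin] with x hx hxa hxP
  exact hx (by simp [hxP, (mem_Ioi.1 hxa).ne'])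

theorem decidedRight_Ioo (p q a : ℝ) : DecidedRight (Ioo p q) a := by
  rcases lt_or_ge a p with h | h
  · right
    filter_upwards [mem_nhdsWithin_of_mem_nhds (Iio_mem_nhds h)] with x hx hx'
    exact lt_asymm hx hx'.1
  rcases lt_or_ge a q with h' | h'
  · left
    filter_upwards [Ioo_mem_nhdsGT h'] with x hx
    exact ⟨h.trans_lt hx.1, hx.2⟩
  · right
    filter_upwards [self_mem_nhdsWithin] with x hx hx'
    exact lt_asymm (h'.trans_lt hx) hx'.2

variable {L}
variable [T : Tame L]

theorem decidedRight {S : Set ℝ} (hS : Dfn L (fun x => x ∈ S)) (a : ℝ) : DecidedRight S a := by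
  have h1 : Def1 L S := dfn_iff_def.1 (hS.comp' (f := fun x : Fin 1 → ℝ => x 0) (by fun_prop))
  obtain ⟨b, c, hb, hc, P, J, h⟩ := T.lom S h1 a
  have h2 : DecidedRight (S ∩ Ioo b c) a := by
    rw [h]
    refine (decidedRight_finset P a).union ?_
    clear h
    classical
    induction J using Finset.induction_on with
    | empty => right; simp
    | insert p J _ ih =>
      rw [Finset.set_biUnion_insert]
      exact (decidedRight_Ioo _ _ a).union ih
  have h3 : ∀ᶠ x in 𝓝[>] a, x ∈ Ioo b c := mem_nhdsWithin_of_mem_nhds (Ioo_mem_nhds hb hc)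
  refine h2.imp (fun h => h.mono fun x hx => hx.1) fun h => ?_
  filter_upwards [h, h3] with x hx hx' hxS using hx ⟨hxS, hx'⟩

theorem interior_nonempty_of_frequently {S : Set ℝ} (hS : Dfn L (fun x => x ∈ S)) {a : ℝ}
    (h : ∃ᶠ x in 𝓝[>] a, x ∈ S) : (interior S).Nonempty := by
  rcases decidedRight hS a with h' | h'
  · obtain ⟨u, hu, hu'⟩ := (mem_nhdsGT_iff_exists_Ioo_subset).1 h'
    obtain ⟨x, hx⟩ := nonempty_Ioo.2 (mem_Ioi.1 hu)
    exact ⟨x, mem_interior.2 ⟨_, hu', isOpen_Ioo, hx⟩⟩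
  · exact absurd h' h

theorem interior_nonempty_of_accPt {S : Set ℝ} (hS : Dfn L (fun x => x ∈ S)) {a : ℝ}
    (h : AccPt a (Filter.principal S)) : (interior S).Nonempty := by
  rw [accPt_iff_frequently_nhdsNE, ← Set.Iio_union_Ioi, nhdsWithin_union,
    Filter.frequently_sup] at h
  rcases h with h | h
  · have hS' : Dfn L (fun x => x ∈ Neg.neg ⁻¹' S) := by
      simp only [Set.mem_preimage]; fun_prop
    have h' : ∃ᶠ x in 𝓝[>] (-a), x ∈ Neg.neg ⁻¹' S := by
      have ht : Filter.Tendsto Neg.neg (𝓝[<] a) (𝓝[>] (-a)) := tendsto_neg_nhdsLT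
      refine ht.frequently (h.mono fun x hx => by simpa using hx)
    obtain ⟨x, hx⟩ := interior_nonempty_of_frequently hS' h'
    rw [← Homeomorph.coe_neg, ← Homeomorph.preimage_interior] at hx
    exact ⟨_, hx⟩
  · exact interior_nonempty_of_frequently hS h

/-- A definable infinite subset of the line has interior. -/
theorem interior_nonempty_of_infinite {S : Set ℝ} (hS : Dfn L (fun x => x ∈ S))
    (hinf : S.Infinite) : (interior S).Nonempty := by
  let g : ℝ → ℝ := fun t => t / (1 + |t|)
  have hpos : ∀ t : ℝ, 0 < 1 + |t| := fun t => by positivity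
  have hg : Continuous g := continuous_id.div (by fun_prop) fun t => (hpos t).ne'
  have hginj : Function.Injective g := by
    intro s t h
    have h0 : s * (1 + |t|) = t * (1 + |s|) := by
      rwa [div_eq_div_iff (hpos s).ne' (hpos t).ne'] at h
    have h1 := hpos s
    have h2 := hpos t
    rcases le_total 0 s with hs | hs <;> rcases le_total 0 t with ht | ht <;>
      simp only [abs_of_nonneg, abs_of_nonpos, hs, ht] at h0 h1 h2 <;> nlinarith
  have hgI : MapsTo g S (Icc (-1) 1) := fun t _ => by
    rw [mem_Icc, ← abs_le, abs_div, abs_of_pos (hpos t), div_le_one (hpos t)]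
    linarith
  have hS' : Dfn L (fun x => x ∈ g '' S) := by
    simp only [Set.mem_image, g]; fun_prop
  obtain ⟨a, -, ha⟩ := (hinf.image hginj.injOn).exists_accPt_of_subset_isCompact isCompact_Icc
    hgI.image_subset
  obtain ⟨x, hx⟩ := interior_nonempty_of_accPt hS' ha
  obtain ⟨t, ht, rfl⟩ := interior_subset hx
  refine ⟨t, mem_interior.2 ⟨g ⁻¹' interior (g '' S), ?_, isOpen_interior.preimage hg, hx⟩⟩
  intro s hs
  obtain ⟨s', hs', e⟩ := interior_subset hs
  rwa [← hginj e]

theorem finite_of_interior_empty {S : Set ℝ} (hS : Dfn L (fun x => x ∈ S))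
    (h : interior S = ∅) : S.Finite := by
  by_contra hinf
  exact (interior_nonempty_of_infinite hS hinf).ne_empty h

theorem interior_sdiff_interior {X : Type*} [TopologicalSpace X] (S : Set X) :
    interior (S \ interior S) = ∅ := by
  refine eq_empty_of_forall_notMem fun x hx => ?_
  exact (interior_subset hx).2 (interior_mono sdiff_subset hx)

variable (L) in
/-- Every definable set is open up to a nowhere dense set. -/
def TameTop (X : Type) [DSpace L X] [TopologicalSpace X] : Prop :=
  ∀ S : Set X, Dfn L (fun x => x ∈ S) → IsNowhereDense (S \ interior S)

theorem tameTop_real : TameTop L ℝ := by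
  intro S hS
  have hd : Dfn L (fun x => x ∈ S \ interior S) := by
    simp only [mem_sdiff, mem_interior_iff_mem_nhds, Metric.mem_nhds_iff, Set.subset_def,
      Metric.mem_ball, Real.dist_eq]
    fun_prop
  have hf := finite_of_interior_empty hd (interior_sdiff_interior S)
  rw [IsNowhereDense, hf.isClosed.closure_eq]
  exact interior_eq_empty_iff_dense_compl.2 (hf.countable.dense_compl ℝ)

/-- A definable function is continuous off a meagre set. -/
theorem isMeagre_discontinuity {X : Type} [DSpace L X] [TopologicalSpace X]
    (hX : TameTop L X) {f : X → ℝ} (hf : Dfn L f) : IsMeagre {x | ¬ ContinuousAt f x} := by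
  have h1 : ∀ p : ℚ × ℚ, IsMeagre (f ⁻¹' Ioo (p.1 : ℝ) p.2 \ interior (f ⁻¹' Ioo (p.1 : ℝ) p.2)) :=
    fun p => (hX _ (by simp only [mem_preimage, mem_Ioo]; fun_prop)).isMeagre
  refine (isMeagre_iUnion h1).mono ?_
  intro x hx
  by_contra hx'
  apply hx
  rw [mem_iUnion, not_exists] at hx'
  rw [ContinuousAt, Real.isTopologicalBasis_Ioo_rat.nhds_hasBasis.tendsto_right_iff]
  rintro s ⟨hs, hxs⟩
  simp only [mem_iUnion, mem_singleton_iff] at hs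
  obtain ⟨a, b, -, rfl⟩ := hs
  have := hx' (a, b)
  simp only [mem_sdiff, mem_preimage, hxs, true_and, not_not] at this
  exact mem_interior_iff_mem_nhds.1 this

end OneVariable

section Topology

variable {L}
variable {X : Type} [DSpace L X]

open Matrix (vecCons vecTail vecHead)

@[fun_prop] theorem Dfn.vecCons {n : ℕ} {f : X → ℝ} {g : X → Fin n → ℝ} (hf : Dfn L f)
    (hg : Dfn L g) : Dfn L (fun x => vecCons (f x) (g x)) := by
  rw [dfn_pi_iff] at hg ⊢
  intro i
  refine Fin.cases ?_ (fun i => ?_) i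
  · simpa using hf
  · simpa using hg i

@[fun_prop] theorem Dfn.vecTail {n : ℕ} {g : X → Fin (n + 1) → ℝ}
    (hg : Dfn L g) : Dfn L (fun x => vecTail (g x)) := by
  rw [dfn_pi_iff] at hg ⊢
  exact fun i => hg i.succ

theorem continuous_vecCons {n : ℕ} :
    Continuous fun p : ℝ × (Fin n → ℝ) => vecCons p.1 p.2 :=
  continuous_fst.matrixVecCons continuous_snd

theorem continuous_vecTail {n : ℕ} : Continuous (vecTail : (Fin (n + 1) → ℝ) → Fin n → ℝ) :=
  continuous_pi fun i => continuous_apply i.succ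

/-- Every open set around a point contains a product neighbourhood. -/
theorem exists_prod_subset {n : ℕ} {U : Set (Fin (n + 1) → ℝ)} {t : ℝ} {x : Fin n → ℝ}
    (hU : U ∈ 𝓝 (vecCons t x)) :
    ∃ V ∈ 𝓝 x, ∃ W ∈ 𝓝 t, ∀ x' ∈ V, ∀ t' ∈ W, vecCons t' x' ∈ U := by
  have := continuous_vecCons.continuousAt.preimage_mem_nhds (x := (t, x)) hU
  rw [nhds_prod_eq, Filter.mem_prod_iff] at this
  obtain ⟨W, hW, V, hV, h⟩ := this
  exact ⟨V, hV, W, hW, fun x' hx' t' ht' => h (mk_mem_prod ht' hx')⟩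

variable [T : Tame L]

theorem mem_interior_pi {n : ℕ} {S : Set (Fin n → ℝ)} {x : Fin n → ℝ} :
    x ∈ interior S ↔ ∃ δ : ℝ, 0 < δ ∧ ∀ y, (∀ i, |y i - x i| < δ) → y ∈ S := by
  rw [mem_interior_iff_mem_nhds, Metric.mem_nhds_iff]
  refine exists_congr fun δ => and_congr_right fun hδ => ?_
  simp only [Set.subset_def, Metric.mem_ball, dist_pi_lt_iff hδ, Real.dist_eq]

theorem dfn_interior {n : ℕ} {S : Set (Fin n → ℝ)} (hS : Dfn L (fun x => x ∈ S)) :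
    Dfn L (fun x => x ∈ interior S) := by
  simp only [mem_interior_pi]; fun_prop

theorem dfn_closure {n : ℕ} {S : Set (Fin n → ℝ)} (hS : Dfn L (fun x => x ∈ S)) :
    Dfn L (fun x => x ∈ closure S) := by
  have h := dfn_interior (S := Sᶜ) (by simp only [mem_compl_iff]; fun_prop)
  simp only [closure_eq_compl_interior_compl, mem_compl_iff]; fun_prop

theorem dfn_continuousAt {n : ℕ} {f : (Fin n → ℝ) → ℝ} (hf : Dfn L f) :
    Dfn L (fun x => ContinuousAt f x) := by
  have : ∀ x, ContinuousAt f x ↔ ∀ ε : ℝ, 0 < ε → ∃ δ : ℝ, 0 < δ ∧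
      ∀ y, (∀ i, |y i - x i| < δ) → |f y - f x| < ε := by
    intro x
    rw [Metric.continuousAt_iff]
    refine forall_congr' fun ε => imp_congr_right fun hε => exists_congr fun δ =>
      and_congr_right fun hδ => forall_congr' fun y => ?_
    rw [dist_pi_lt_iff hδ]; simp only [Real.dist_eq]
  simp only [this]; fun_prop

theorem tameTop_of_empty_interior {n : ℕ}
    (h : ∀ S : Set (Fin n → ℝ), Dfn L (fun x => x ∈ S) → interior S = ∅ → IsNowhereDense S) :
    TameTop L (Fin n → ℝ) := by
  intro S hS
  have := dfn_interior hS
  exact h _ (by simp only [mem_sdiff]; fun_prop) (interior_sdiff_interior S)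

omit T in
theorem isNowhereDense_of_interior_empty {X : Type} [TopologicalSpace X] [DSpace L X]
    (hX : TameTop L X) {S : Set X} (hS : Dfn L (fun x => x ∈ S)) (h : interior S = ∅) :
    IsNowhereDense S := by
  simpa [h] using hX S hS

theorem exists_rat_Ioo_subset {S : Set ℝ} {t : ℝ} (h : S ∈ 𝓝 t) :
    ∃ p : ℚ × ℚ, t ∈ Ioo (p.1 : ℝ) p.2 ∧ Ioo (p.1 : ℝ) p.2 ⊆ S := by
  obtain ⟨s, hs, hts, hsS⟩ := Real.isTopologicalBasis_Ioo_rat.mem_nhds_iff.1 h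
  simp only [mem_iUnion, mem_singleton_iff] at hs
  obtain ⟨a, b, -, rfl⟩ := hs
  exact ⟨(a, b), hts, hsS⟩

theorem exists_mem_of_isMeagre {n : ℕ} {S U : Set (Fin n → ℝ)} (hS : IsMeagre S) {x : Fin n → ℝ}
    (hU : U ∈ 𝓝 x) : ∃ y ∈ U, y ∉ S := by
  obtain ⟨y, hy, hy'⟩ := (dense_of_mem_residual hS).inter_nhds_nonempty hU
  exact ⟨y, hy', hy⟩

/-- The fibre of `S ⊆ ℝⁿ⁺¹` over a point of `ℝⁿ`. -/
def fibre {n : ℕ} (S : Set (Fin (n + 1) → ℝ)) (x : Fin n → ℝ) : Set ℝ := {t | vecCons t x ∈ S}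

omit [DSpace L X] T [L.Structure ℝ] in
theorem mem_fibre {n : ℕ} {S : Set (Fin (n + 1) → ℝ)} {x : Fin n → ℝ} {t : ℝ} :
    t ∈ fibre S x ↔ vecCons t x ∈ S := Iff.rfl

/-- Generically, the fibre of the closure is the closure of the fibre. -/
theorem isMeagre_fibre_closure {n : ℕ} (hn : TameTop L (Fin n → ℝ)) {S : Set (Fin (n + 1) → ℝ)}
    (hS : Dfn L (fun x => x ∈ S)) :
    IsMeagre {x | ¬ fibre (closure S) x ⊆ closure (fibre S x)} := by
  let B : ℚ × ℚ → Set (Fin n → ℝ) := fun p =>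
    {x | ∀ t : ℝ, t ∈ Ioo (p.1 : ℝ) p.2 → vecCons t x ∉ S}
  have hB : ∀ p, Dfn L (fun x => x ∈ B p) := fun p => by
    simp only [B, Set.mem_ofPred_eq, mem_Ioo]; fun_prop
  refine (isMeagre_iUnion fun p => (hn _ (hB p)).isMeagre).mono fun x hx => ?_
  simp only [Set.mem_ofPred_eq, Set.subset_def, not_forall] at hx
  obtain ⟨t, ht, ht'⟩ := hx
  obtain ⟨p, hp, hpS⟩ := exists_rat_Ioo_subset (isClosed_closure.isOpen_compl.mem_nhds ht')
  refine mem_iUnion.2 ⟨p, fun t ht h => hpS ht (subset_closure h), fun hi => ?_⟩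
  have hU : {z : Fin (n + 1) → ℝ | vecTail z ∈ interior (B p) ∧ z 0 ∈ Ioo (p.1 : ℝ) p.2}
      ∈ 𝓝 (vecCons t x) :=
    ((isOpen_interior.preimage continuous_vecTail).inter
      (isOpen_Ioo.preimage (continuous_apply 0))).mem_nhds ⟨by simpa using hi, by simpa using hp⟩
  obtain ⟨z, hz, hzS⟩ := mem_closure_iff_nhds.1 ht _ hU
  exact interior_subset hz.1 (z 0) hz.2 (by rwa [← Matrix.cons_head_tail z] at hzS)

theorem isMeagre_fibre_interior {n : ℕ} (hn : TameTop L (Fin n → ℝ)) {S : Set (Fin (n + 1) → ℝ)}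
    (hS : Dfn L (fun x => x ∈ S)) (h : interior S = ∅) :
    IsMeagre {x | (interior (fibre S x)).Nonempty} := by
  let A : ℚ × ℚ → Set (Fin n → ℝ) := fun p =>
    {x | ∀ t : ℝ, t ∈ Ioo (p.1 : ℝ) p.2 → vecCons t x ∈ S}
  have hA : ∀ p, Dfn L (fun x => x ∈ A p) := fun p => by
    simp only [A, Set.mem_ofPred_eq, mem_Ioo]; fun_prop
  refine (isMeagre_iUnion fun p => (hn _ (hA p)).isMeagre).mono fun x ⟨t, ht⟩ => ?_
  obtain ⟨p, hp, hpS⟩ := exists_rat_Ioo_subset (mem_interior_iff_mem_nhds.1 ht)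
  refine mem_iUnion.2 ⟨p, fun t ht => hpS ht, fun hi => ?_⟩
  refine notMem_empty (vecCons t x) (h ▸ mem_interior.2
    ⟨{z : Fin (n + 1) → ℝ | vecTail z ∈ interior (A p) ∧ z 0 ∈ Ioo (p.1 : ℝ) p.2}, ?_,
    (isOpen_interior.preimage continuous_vecTail).inter
      (isOpen_Ioo.preimage (continuous_apply 0)), by simpa using hi, by simpa using hp⟩)
  intro z hz
  have := interior_subset hz.1 (z 0) hz.2
  rwa [← Matrix.cons_head_tail z]

omit T in
theorem dfn_fibre {n : ℕ} {S : Set (Fin (n + 1) → ℝ)} (hS : Dfn L (fun x => x ∈ S))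
    (x : Fin n → ℝ) : Dfn L (fun t => t ∈ fibre S x) := by
  simp only [mem_fibre]; fun_prop

/-- Every definable set in `ℝⁿ` is open up to a nowhere dense set. -/
theorem tameTop_pi : ∀ n : ℕ, TameTop L (Fin n → ℝ)
  | 0 => tameTop_of_empty_interior fun S _ h => by
      rcases S.eq_empty_or_nonempty with rfl | hS
      · exact isNowhereDense_empty
      · rw [Subsingleton.eq_univ_of_nonempty hS, interior_univ] at h
        exact absurd h univ_nonempty.ne_empty
  | n + 1 => tameTop_of_empty_interior fun S hS h => by
      have ih := tameTop_pi n
      refine eq_empty_of_forall_notMem fun z hz => ?_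
      rw [← Matrix.cons_head_tail z, mem_interior_iff_mem_nhds] at hz
      obtain ⟨V, hV, W, hW, hVW⟩ := exists_prod_subset hz
      obtain ⟨x, hxV, hx⟩ := exists_mem_of_isMeagre
        ((isMeagre_fibre_closure ih hS).union (isMeagre_fibre_interior ih hS h)) hV
      simp only [mem_union, Set.mem_ofPred_eq, not_or, not_not, Set.not_nonempty_iff_eq_empty] at hx
      have hf := finite_of_interior_empty (dfn_fibre hS x) hx.2
      have : W ⊆ fibre S x := fun t ht => by
        rw [← hf.isClosed.closure_eq]
        exact hx.1 (hVW x hxV t ht)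
      exact (hx.2.subset (mem_interior_iff_mem_nhds.2 (Filter.mem_of_superset hW this))).elim

end Topology

section UniformFiniteness

variable {L}
variable {X : Type} [DSpace L X] [T : Tame L]

/-- A definable family of finite sets of bounded cardinality is enumerated by finitely many
definable functions. -/
theorem exists_enumeration (K : ℕ) : ∀ {E : X → ℝ → Prop},
    Dfn L (fun q : X × ℝ => E q.1 q.2) → (∀ x, {y | E x y}.Finite) →
    (∀ x, {y | E x y}.ncard ≤ K) →
    ∃ f : Fin K → X → ℝ, (∀ i, Dfn L (f i)) ∧ ∀ x y, E x y → ∃ i, y = f i x := by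
  induction K with
  | zero =>
    intro E hE hfin hK
    refine ⟨fun i => i.elim0, fun i => i.elim0, fun x y hxy => ?_⟩
    have := (Set.ncard_eq_zero (hfin x)).1 (Nat.le_zero.1 (hK x))
    exact absurd hxy (fun h => this.le h)
  | succ K ih =>
    intro E hE hfin hK
    let g : X → ℝ := fun x => sSup {y | E x y}
    have hg : Dfn L g := by fun_prop
    obtain ⟨f, hf, hf'⟩ := ih (E := fun x y => E x y ∧ y ≠ g x) (by fun_prop)
      (fun x => (hfin x).subset fun y hy => hy.1) (fun x => by
        rcases Set.eq_empty_or_nonempty {y | E x y} with h | h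
        · have : {y | E x y ∧ y ≠ g x} = ∅ :=
            Set.subset_empty_iff.1 fun y hy => h.subset hy.1
          simp [this]
        · have hm : g x ∈ {y | E x y} := h.csSup_mem (hfin x)
          have : {y | E x y ∧ y ≠ g x} = {y | E x y} \ {g x} := rfl
          rw [this, Set.ncard_sdiff_singleton_of_mem hm]
          have := hK x
          omega)
    refine ⟨Fin.cons g f, fun i => Fin.cases hg hf i, fun x y hxy => ?_⟩
    by_cases hy : y = g x
    · exact ⟨0, hy⟩
    · obtain ⟨i, hi⟩ := hf' x y ⟨hxy, hy⟩
      exact ⟨i.succ, hi⟩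

/-- Uniform bounds for the cardinalities of definable families of finite sets. -/
def UniformlyFinite (L : FirstOrder.Language) [L.Structure ℝ] (X : Type) [DSpace L X] : Prop :=
  ∀ E : X → ℝ → Prop, Dfn L (fun q : X × ℝ => E q.1 q.2) → (∀ x, {y | E x y}.Finite) →
    ∃ K : ℕ, ∀ x, {y | E x y}.ncard ≤ K

theorem exists_pos_forall_le {I : Type*} [Finite I] {δ : I → ℝ} (h : ∀ i, 0 < δ i) :
    ∃ d : ℝ, 0 < d ∧ ∀ i, d ≤ δ i := by
  have h1 : ∀ᶠ d in 𝓝[>] (0 : ℝ), ∀ i, d ≤ δ i :=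
    Filter.eventually_all.2 fun i =>
      Filter.mem_of_superset (Ioo_mem_nhdsGT (h i)) fun d hd => hd.2.le
  obtain ⟨d, hd, hd'⟩ := (h1.and self_mem_nhdsWithin).exists
  exact ⟨d, hd', hd⟩

/-- The fibres of `e` vary continuously near `t` and stay uniformly discrete. -/
def RegularFibre (e : ℝ → ℝ → Prop) (t : ℝ) : Prop :=
  (∃ δ : ℝ, 0 < δ ∧ ∀ᶠ t' in 𝓝 t, ∀ y y', e t' y → e t' y' → y ≠ y' → δ ≤ |y - y'|) ∧
  ∀ ε : ℝ, 0 < ε → ∀ᶠ t' in 𝓝 t, (∀ y, e t y → ∃ y', e t' y' ∧ |y - y'| < ε) ∧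
    ∀ y', e t' y' → ∃ y, e t y ∧ |y' - y| < ε

theorem ncard_le_of_separated {A B : Set ℝ} (hB : B.Finite) {δ : ℝ}
    (hA : ∀ y ∈ A, ∀ y' ∈ A, y ≠ y' → δ ≤ |y - y'|) (h : ∀ y ∈ A, ∃ y' ∈ B, |y - y'| < δ / 2) :
    A.ncard ≤ B.ncard := by
  choose! g hgB hg using h
  refine Set.ncard_le_ncard_of_injOn g hgB (fun y hy y' hy' he => ?_) hB
  by_contra hne
  have h1 := hg y hy
  have h2 := hg y' hy'
  have h3 := hA y hy y' hy' hne
  rw [← he] at h2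
  have := abs_sub_le y (g y) y'
  rw [abs_sub_comm (g y) y'] at this
  linarith

theorem RegularFibre.ncard_eq {e : ℝ → ℝ → Prop} (he : ∀ t, {y | e t y}.Finite) {t : ℝ}
    (h : RegularFibre e t) : ∀ᶠ t' in 𝓝 t, {y | e t' y}.ncard = {y | e t y}.ncard := by
  obtain ⟨⟨δ, hδ, h1⟩, h2⟩ := h
  have h3 := h1.self_of_nhds
  filter_upwards [h1, h2 (δ / 2) (half_pos hδ)] with t' h1 h2
  exact le_antisymm (ncard_le_of_separated (he t) (fun y hy y' hy' => h1 y y' hy hy') h2.2)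
    (ncard_le_of_separated (he t') (fun y hy y' hy' => h3 y y' hy hy') h2.1)

theorem ncard_eq_iff {A : Set ℝ} (hA : A.Finite) (m : ℕ) :
    A.ncard = m ↔ ∃ y : Fin m → ℝ, (∀ i j, y i = y j → i = j) ∧ ∀ z, z ∈ A ↔ ∃ i, z = y i := by
  constructor
  · rintro rfl
    have : Fintype A := hA.fintype
    have e : A ≃ Fin A.ncard := Fintype.equivFinOfCardEq (by rw [← Nat.card_eq_fintype_card]; rfl)
    refine ⟨fun i => e.symm i, fun i j h => by simpa using Subtype.ext h, fun z => ⟨fun hz => ?_, ?_⟩⟩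
    · exact ⟨e ⟨z, hz⟩, by simp⟩
    · rintro ⟨i, rfl⟩; exact (e.symm i).2
  · rintro ⟨y, hy, h⟩
    have : A = range y := by ext z; simp [h, eq_comm]
    rw [this, ← image_univ, Set.ncard_image_of_injective _ (fun i j => hy i j)]
    simp

theorem finite_irregular {e : ℝ → ℝ → Prop} (hd : Dfn L (fun q : ℝ × ℝ => e q.1 q.2))
    (he : ∀ t, {y | e t y}.Finite) : {t | ¬ RegularFibre e t}.Finite := by
  by_contra hinf
  have hI := interior_nonempty_of_infinite (L := L) (S := {t | ¬ RegularFibre e t}) (by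
    simp only [Set.mem_ofPred_eq, RegularFibre, Metric.eventually_nhds_iff, Real.dist_eq]
    fun_prop) hinf
  set J := interior {t | ¬ RegularFibre e t}
  have hJu : ¬ J.Countable := fun h =>
    (h.dense_compl ℝ).inter_open_nonempty _ isOpen_interior hI |>.elim fun x hx => hx.2 hx.1
  obtain ⟨m, hm⟩ : ∃ m : ℕ, (J ∩ {t | {y | e t y}.ncard = m}).Infinite := by
    by_contra! h
    refine hJu ((countable_iUnion fun m : ℕ => (h m).countable).mono fun t ht => ?_)
    exact mem_iUnion.2 ⟨_, ht, rfl⟩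
  have hdJ : Dfn L (fun t => t ∈ J) := by
    simp only [J, mem_interior_iff_mem_nhds, Metric.mem_nhds_iff, Set.subset_def,
      Metric.mem_ball, Real.dist_eq, Set.mem_ofPred_eq, RegularFibre, Metric.eventually_nhds_iff]
    fun_prop
  have hdS : Dfn L (fun t => t ∈ J ∩ {t | {y | e t y}.ncard = m}) := by
    simp only [mem_inter_iff, Set.mem_ofPred_eq, ncard_eq_iff (he _)]
    fun_prop
  have hSne := interior_nonempty_of_infinite hdS hm
  set S := J ∩ {t | {y | e t y}.ncard = m}
  obtain ⟨f, hf, hf'⟩ := exists_enumeration (L := L) m (E := fun t y => e t y ∧ t ∈ S) (by fun_prop)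
    (fun t => (he t).subset fun y hy => hy.1) (fun t => by
      by_cases ht : t ∈ S
      · simpa [ht] using ht.2.le
      · simp [ht])
  obtain ⟨t, htS, ht⟩ : ∃ t ∈ interior S, ∀ i, ContinuousAt (f i) t := by
    have := isMeagre_iUnion fun i => isMeagre_discontinuity tameTop_real (hf i)
    obtain ⟨t, ht, ht'⟩ := (dense_of_mem_residual this).inter_open_nonempty _ isOpen_interior hSne
    refine ⟨t, ht, fun i => ?_⟩
    by_contra hc
    exact ht' (mem_iUnion.2 ⟨i, hc⟩)
  have hfib : ∀ t ∈ S, (∀ y, e t y ↔ ∃ i, y = f i t) ∧ ∀ i j, f i t = f j t → i = j := by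
    intro t ht
    have h1 : {y | e t y} ⊆ range fun i => f i t := fun y hy => by
      obtain ⟨i, hi⟩ := hf' t y ⟨hy, ht⟩
      exact ⟨i, hi.symm⟩
    have h2 : (range fun i => f i t).ncard ≤ m := by
      rw [← image_univ]
      exact (Set.ncard_image_le finite_univ).trans (by simp)
    have h3 := Set.eq_of_subset_of_ncard_le h1 (h2.trans ht.2.ge) (finite_range _)
    refine ⟨fun y => ?_, ?_⟩
    · rw [← Set.mem_ofPred_eq (p := fun y => e t y), h3]; simp [eq_comm]
    · have : (univ : Set (Fin m)).InjOn fun i => f i t := by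
        refine Set.injOn_of_ncard_image_eq ?_ finite_univ
        rw [image_univ, ← h3, ht.2]; simp
      exact fun i j h => this (mem_univ _) (mem_univ _) h
  have hS : ∀ᶠ t' in 𝓝 t, t' ∈ S := mem_interior_iff_mem_nhds.1 htS
  have htS' := interior_subset htS
  refine interior_subset (htS'.1 : t ∈ interior _) ⟨?_, fun ε hε => ?_⟩
  · have hlim : ∀ i j, ∃ δ : ℝ, 0 < δ ∧ (i ≠ j → ∀ᶠ t' in 𝓝 t, δ ≤ |f i t' - f j t'|) := by
      intro i j
      by_cases hij : i = j
      · exact ⟨1, one_pos, fun h => absurd hij h⟩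
      have hpos : 0 < |f i t - f j t| := abs_pos.2 fun h =>
        hij ((hfib t htS').2 i j (sub_eq_zero.1 h))
      refine ⟨|f i t - f j t| / 2, half_pos hpos, fun _ => ?_⟩
      exact (((ht i).sub (ht j)).abs.eventually (lt_mem_nhds (half_lt_self hpos))).mono
        fun _ h => h.le
    choose δ hδ hδ' using hlim
    obtain ⟨δ0, hδ0, hδ0'⟩ : ∃ δ0 : ℝ, 0 < δ0 ∧ ∀ i j, δ0 ≤ δ i j := by
      obtain ⟨d, hd, hd'⟩ := exists_pos_forall_le (fun p : Fin m × Fin m => hδ p.1 p.2)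
      exact ⟨d, hd, fun i j => hd' (i, j)⟩
    refine ⟨δ0, hδ0, ?_⟩
    have : ∀ᶠ t' in 𝓝 t, ∀ i j, i ≠ j → δ i j ≤ |f i t' - f j t'| := by
      simp only [Filter.eventually_all]
      exact hδ'
    filter_upwards [this, hS] with t' h1 h2 y y' hy hy' hne
    obtain ⟨i, rfl⟩ := ((hfib t' h2).1 _).1 hy
    obtain ⟨j, rfl⟩ := ((hfib t' h2).1 _).1 hy'
    exact (hδ0' i j).trans (h1 i j fun h => hne (h ▸ rfl))
  · have : ∀ᶠ t' in 𝓝 t, ∀ i, |f i t' - f i t| < ε := by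
      rw [Filter.eventually_all]
      exact fun i => Metric.tendsto_nhds.1 (ht i) ε hε
    filter_upwards [this, hS] with t' h1 h2
    constructor
    · intro y hy
      obtain ⟨i, rfl⟩ := ((hfib t htS').1 _).1 hy
      exact ⟨f i t', ((hfib t' h2).1 _).2 ⟨i, rfl⟩, by rw [abs_sub_comm]; exact h1 i⟩
    · intro y hy
      obtain ⟨i, rfl⟩ := ((hfib t' h2).1 _).1 hy
      exact ⟨f i t, ((hfib t htS').1 _).2 ⟨i, rfl⟩, h1 i⟩

theorem exists_lower {K : ℕ} {P : Set ℝ} (hP : P.Finite) {b : Fin K → ℝ}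
    (hb : ∀ p ∈ P, ∃ i, p = b i) {t : ℝ} (ht : t ∉ P) :
    (∃ i, b i ∈ P ∧ b i < t ∧ ∀ p ∈ P, b i < p → t < p) ∨ ∀ p ∈ P, t < p := by
  rcases (P ∩ Iio t).eq_empty_or_nonempty with h | h
  · right
    intro p hp
    by_contra hpt
    exact notMem_empty p (h ▸ ⟨hp, lt_of_le_of_ne (not_lt.1 hpt) fun h => ht (h ▸ hp)⟩)
  · left
    obtain ⟨a, ⟨haP, hat⟩, ha⟩ := Set.exists_max_image _ id (hP.inter_of_left (Iio t)) h
    obtain ⟨i, rfl⟩ := hb a haP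
    refine ⟨i, haP, hat, fun p hp hap => ?_⟩
    by_contra hpt
    exact (ha p ⟨hp, lt_of_le_of_ne (not_lt.1 hpt) fun h => ht (h ▸ hp)⟩).not_gt hap

theorem exists_upper {K : ℕ} {P : Set ℝ} (hP : P.Finite) {b : Fin K → ℝ}
    (hb : ∀ p ∈ P, ∃ i, p = b i) {t : ℝ} (ht : t ∉ P) :
    (∃ i, b i ∈ P ∧ t < b i ∧ ∀ p ∈ P, p < b i → p < t) ∨ ∀ p ∈ P, p < t := by
  rcases exists_lower (P := Neg.neg ⁻¹' P) (hP.preimage neg_injective.injOn) (b := fun i => - b i)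
    (fun p hp => (hb _ hp).imp fun i hi => by rw [← hi, neg_neg]) (t := -t) (by simpa using ht)
    with ⟨i, h1, h2, h3⟩ | h
  · refine Or.inl ⟨i, by simpa using h1, by simpa using h2, fun p hp h => ?_⟩
    have := h3 (-p) (by simpa using hp) (by simpa using h)
    simpa using this
  · exact Or.inr fun p hp => by simpa using h (-p) (by simpa using hp)

/-- Sample points meeting every component of the complement of `{b i}`, and every `b i`. -/
noncomputable def samplePoint {K : ℕ} (b : Fin K → ℝ) : Option (Fin K) × Option (Fin K) → ℝ
  | (none, none) => 0
  | (some i, none) => b i + 1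
  | (none, some j) => b j - 1
  | (some i, some j) => (b i + b j) / 2

theorem exists_samplePoint {K : ℕ} {P : Set ℝ} (hP : P.Finite) {b : Fin K → ℝ}
    (hb : ∀ p ∈ P, ∃ i, p = b i) {t : ℝ} (ht : t ∉ P) :
    ∃ j, ∀ s ∈ uIcc t (samplePoint b j), s ∉ P := by
  rcases exists_lower hP hb ht with ⟨i, -, h1, h1'⟩ | h1 <;>
  rcases exists_upper hP hb ht with ⟨j, -, h2, h2'⟩ | h2
  · refine ⟨(some i, some j), fun s hs hsP => ?_⟩
    rw [samplePoint, mem_uIcc] at hs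
    have := h1' s hsP (by rcases hs with h | h <;> linarith)
    have := h2' s hsP (by rcases hs with h | h <;> linarith)
    linarith
  · refine ⟨(some i, none), fun s hs hsP => ?_⟩
    rw [samplePoint, mem_uIcc] at hs
    have := h1' s hsP (by rcases hs with h | h <;> linarith)
    have := h2 s hsP
    linarith
  · refine ⟨(none, some j), fun s hs hsP => ?_⟩
    rw [samplePoint, mem_uIcc] at hs
    have := h2' s hsP (by rcases hs with h | h <;> linarith)
    have := h1 s hsP
    linarith
  · exact ⟨(none, none), fun s _ hsP => lt_asymm (h1 s hsP) (h2 s hsP)⟩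

theorem UniformlyFinite.prod_real (hX : UniformlyFinite L X) : UniformlyFinite L (X × ℝ) := by
  intro E hE hfin
  have hfib : ∀ x, Dfn L (fun q : ℝ × ℝ => E (x, q.1) q.2) := fun x => by fun_prop
  have hP := fun x => finite_irregular (hfib x) fun t => hfin (x, t)
  have hB : Dfn L (fun q : X × ℝ => ¬ RegularFibre (fun t y => E (q.1, t) y) q.2) := by
    simp only [RegularFibre, Metric.eventually_nhds_iff, Real.dist_eq]
    fun_prop
  obtain ⟨K, hK⟩ := hX _ hB hP
  obtain ⟨b, hb, hb'⟩ := exists_enumeration K hB hP hK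
  have hs : ∀ j, Dfn L (fun x => samplePoint (fun i => b i x) j) := by
    rintro ⟨_ | i, _ | j⟩ <;> simp only [samplePoint] <;> fun_prop
  have hN : ∀ j, ∃ N : ℕ, ∀ x, {y | E (x, samplePoint (fun i => b i x) j) y}.ncard ≤ N := fun j => by
    have : ∀ c : X → ℝ, Dfn L c → ∃ N : ℕ, ∀ x, {y | E (x, c x) y}.ncard ≤ N := fun c hc =>
      hX (fun x y => E (x, c x) y) (by fun_prop) fun x => hfin _
    exact this _ (hs j)
  choose N hN using hN
  refine ⟨∑ j, N j, fun ⟨x, t⟩ => ?_⟩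
  obtain ⟨j, hj⟩ : ∃ j, {y | E (x, t) y}.ncard =
      {y | E (x, samplePoint (fun i => b i x) j) y}.ncard := by
    by_cases ht : RegularFibre (fun t y => E (x, t) y) t
    · obtain ⟨j, hj⟩ := exists_samplePoint (hP x) (b := fun i => b i x) (hb' x) (t := t)
        (by simpa using ht)
      refine ⟨j, isPreconnected_uIcc.constant (f := fun t => {y | E (x, t) y}.ncard)
        (fun s hs => ?_) left_mem_uIcc right_mem_uIcc⟩
      have h1 : RegularFibre (fun t y => E (x, t) y) s := by simpa using hj s hs
      have h2 := h1.ncard_eq fun t => hfin (x, t)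
      exact (Filter.EventuallyEq.continuousAt h2).continuousWithinAt
    · obtain ⟨i, rfl⟩ := hb' x t ht
      exact ⟨(some i, some i), by simp [samplePoint]⟩
  rw [hj]
  exact (hN j x).trans (Finset.single_le_sum (f := N) (fun _ _ => Nat.zero_le _) (Finset.mem_univ j))

theorem uniformlyFinite_pi : ∀ n : ℕ, UniformlyFinite L (Fin n → ℝ)
  | 0 => fun E _ _ => ⟨{y | E default y}.ncard, fun x => by rw [Subsingleton.elim x default]⟩
  | n + 1 => fun E hE hfin => by
      obtain ⟨K, hK⟩ := (uniformlyFinite_pi n).prod_real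
        (fun p y => E (Matrix.vecCons p.2 p.1) y) (by fun_prop) fun p => hfin _
      refine ⟨K, fun z => ?_⟩
      have := hK (Matrix.vecTail z, Matrix.vecHead z)
      simpa only [Matrix.cons_head_tail] using this

end UniformFiniteness

section SmallSets

variable {L}
variable [T : Tame L]

open Matrix (vecCons vecTail)

theorem interior_eq_empty_of_isMeagre {n : ℕ} {S : Set (Fin n → ℝ)} (hS : IsMeagre S) :
    interior S = ∅ := by
  refine eq_empty_of_forall_notMem fun x hx => ?_
  obtain ⟨y, hy, hy'⟩ := exists_mem_of_isMeagre hS (mem_interior_iff_mem_nhds.1 hx)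
  exact hy' hy

/-- A property of definable sets holds for all definable sets without interior as soon as it is
stable under finite unions and holds for definable sets on which some projection to fewer
coordinates is injective. -/
theorem induction_of_interior_empty : ∀ (d : ℕ) (P : Set (Fin d → ℝ) → Prop),
    (∀ (K : ℕ) (S : Fin K → Set (Fin d → ℝ)), (∀ i, P (S i)) → P (⋃ i, S i)) →
    (∀ (S : Set (Fin d → ℝ)), Dfn L (fun x => x ∈ S) → ∀ d' < d, ∀ σ : Fin d' → Fin d,
      InjOn (fun x : Fin d → ℝ => x ∘ σ) S → P S) →
    ∀ S : Set (Fin d → ℝ), Dfn L (fun x => x ∈ S) → interior S = ∅ → P S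
  | 0, P, hU, _, S, _, hS => by
    have : S = ∅ := by
      by_contra hne
      rw [← Ne, ← Set.nonempty_iff_ne_empty] at hne
      rw [Subsingleton.eq_univ_of_nonempty hne, interior_univ] at hS
      exact univ_nonempty.ne_empty hS
    have h := hU 0 (fun _ => ∅) fun i => i.elim0
    rwa [iUnion_of_empty, ← this] at h
  | d + 1, P, hU, hI, S, hS, hS0 => by
    have hfibd : Dfn L (fun x : Fin d → ℝ => (interior (fibre S x)).Nonempty) := by
      simp only [Set.Nonempty, mem_interior_iff_mem_nhds, Metric.mem_nhds_iff, Set.subset_def,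
        Metric.mem_ball, Real.dist_eq, mem_fibre]
      fun_prop
    have h1 := interior_eq_empty_of_isMeagre (isMeagre_fibre_interior (tameTop_pi d) hS hS0)
    set A : Set (Fin d → ℝ) := {x | (interior (fibre S x)).Nonempty} with hA
    have hAd : Dfn L (fun x => x ∈ A) := hfibd
    have hPA : P (S ∩ vecTail ⁻¹' A) := by
      refine induction_of_interior_empty d (fun B => P (S ∩ vecTail ⁻¹' B)) ?_ ?_ A hAd h1
      · intro K B hB
        rw [preimage_iUnion, inter_iUnion]
        exact hU K _ hB
      · intro B hB d' hd' σ hσ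
        refine hI _ ?_ (d' + 1) (by omega) (Fin.cons 0 fun i => (σ i).succ) ?_
        · simp only [mem_inter_iff, mem_preimage]; fun_prop
        · rintro z ⟨-, hz⟩ w ⟨-, hw⟩ h
          have h0 : z 0 = w 0 := congr_fun h 0
          have ht : vecTail z = vecTail w := hσ hz hw (funext fun i => congr_fun h i.succ)
          rw [← Matrix.cons_head_tail z, ← Matrix.cons_head_tail w, ht]
          congr 1
    let E : (Fin d → ℝ) → ℝ → Prop := fun x t => x ∉ A ∧ vecCons t x ∈ S
    have hE : Dfn L (fun q : (Fin d → ℝ) × ℝ => E q.1 q.2) := by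
      simp only [E]; fun_prop
    have hEfin : ∀ x, {t | E x t}.Finite := fun x => by
      by_cases hx : x ∈ A
      · simp [E, hx]
      · simp only [E, hx, not_false_eq_true, true_and]
        exact finite_of_interior_empty (dfn_fibre hS x) (Set.not_nonempty_iff_eq_empty.1 hx)
    obtain ⟨K, hK⟩ := uniformlyFinite_pi d E hE hEfin
    obtain ⟨f, hf, hf'⟩ := exists_enumeration K hE hEfin hK
    have hPB : P (⋃ i, {z | z ∈ S ∧ vecTail z ∉ A ∧ z 0 = f i (vecTail z)}) := by
      refine hU K _ fun i => hI _ ?_ d (by omega) Fin.succ ?_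
      · simp only [Set.mem_ofPred_eq]; fun_prop
      · rintro z ⟨-, -, hz⟩ w ⟨-, -, hw⟩ h
        have ht : vecTail z = vecTail w := h
        rw [← Matrix.cons_head_tail z, ← Matrix.cons_head_tail w, ht]
        congr 1
        exact hz.trans ((congr_arg (f i) ht).trans hw.symm)
    have := hU 2 ![S ∩ vecTail ⁻¹' A,
      ⋃ i, {z | z ∈ S ∧ vecTail z ∉ A ∧ z 0 = f i (vecTail z)}] (by
      intro i
      fin_cases i
      · exact hPA
      · exact hPB)
    convert this using 1
    ext z
    rw [mem_iUnion, Fin.exists_fin_two]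
    simp only [Matrix.cons_val_zero, Matrix.cons_val_one, mem_iUnion, mem_inter_iff,
      mem_preimage, Set.mem_ofPred_eq]
    refine ⟨fun hz => ?_, ?_⟩
    · by_cases hzA : vecTail z ∈ A
      · exact Or.inl ⟨hz, hzA⟩
      · obtain ⟨i, hi⟩ := hf' (vecTail z) (z 0)
          ⟨hzA, (Matrix.cons_head_tail z).symm ▸ hz⟩
        exact Or.inr ⟨i, hz, hzA, hi⟩
    · rintro (h | ⟨i, h⟩) <;> exact h.1

variable (L) in
/-- Dense open definable sets. -/
structure Generic {d : ℕ} (W : Set (Fin d → ℝ)) : Prop where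
  isOpen : IsOpen W
  interior_compl : interior Wᶜ = ∅
  dfn : Dfn L fun x => x ∈ W

theorem Generic.interior_of_isMeagre {d : ℕ} {Z : Set (Fin d → ℝ)} (hZ : IsMeagre Zᶜ)
    (hd : Dfn L (fun x => x ∈ Z)) : Generic L (interior Z) := by
  refine ⟨isOpen_interior, ?_, dfn_interior hd⟩
  rw [← closure_compl]
  exact isNowhereDense_of_interior_empty (tameTop_pi d) (S := Zᶜ)
    (by simp only [mem_compl_iff]; fun_prop) (interior_eq_empty_of_isMeagre hZ)

omit T in
theorem Generic.isMeagre {d : ℕ} {W : Set (Fin d → ℝ)} (h : Generic L W) : IsMeagre Wᶜ := by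
  have := h.interior_compl
  rw [← h.isOpen.isClosed_compl.closure_eq] at this
  exact IsNowhereDense.isMeagre this

theorem Generic.iInter {d : ℕ} {I : Type} [Finite I] {W : I → Set (Fin d → ℝ)}
    (h : ∀ i, Generic L (W i)) : Generic L (⋂ i, W i) := by
  have h1 : IsOpen (⋂ i, W i) := isOpen_iInter_of_finite fun i => (h i).isOpen
  have h2 := fun i => (h i).dfn
  have := Generic.interior_of_isMeagre (L := L) (Z := ⋂ i, W i)
    (by rw [compl_iInter]; exact isMeagre_iUnion fun i => (h i).isMeagre)
    (by simp only [mem_iInter]; fun_prop)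
  rwa [h1.interior_eq] at this

theorem Generic.inter {d : ℕ} {W W' : Set (Fin d → ℝ)}
    (h : Generic L W) (h' : Generic L W') : Generic L (W ∩ W') := by
  have := Generic.iInter (L := L) (W := fun b : Bool => cond b W W') (by rintro (_ | _) <;> assumption)
  rwa [← Set.inter_eq_iInter] at this

theorem generic_continuousAt {d : ℕ} {f : (Fin d → ℝ) → ℝ} (hf : Dfn L f) :
    Generic L (interior {x | ContinuousAt f x}) :=
  Generic.interior_of_isMeagre (isMeagre_discontinuity (tameTop_pi d) hf) (dfn_continuousAt hf)

end SmallSets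

section Differentiability

variable {L}
variable {X : Type} [DSpace L X]

theorem hasDerivAt_iff_forall_exists {f : ℝ → ℝ} {l t : ℝ} :
    HasDerivAt f l t ↔ ∀ c : ℝ, 0 < c → ∃ δ : ℝ, 0 < δ ∧ ∀ y, |y - t| < δ →
      |f y - f t - (y - t) * l| ≤ c * |y - t| := by
  simp only [hasDerivAt_iff_isLittleO, Asymptotics.isLittleO_iff, Metric.eventually_nhds_iff,
    Real.dist_eq, Real.norm_eq_abs, smul_eq_mul]

/-- An uncountable union of countably many definable sets of reals has a part with interior. -/
theorem exists_interior_of_iUnion [T : Tame L] {S : ℕ → Set ℝ} (hS : ∀ m, Dfn L (fun x => x ∈ S m))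
    {J : Set ℝ} (hJ : (interior J).Nonempty) (h : J ⊆ ⋃ m, S m) : ∃ m, (interior (S m)).Nonempty := by
  by_contra! hne
  have : J.Countable := (countable_iUnion fun m =>
    (finite_of_interior_empty (hS m) (hne m)).countable).mono h
  obtain ⟨x, hx, hx'⟩ := (this.dense_compl ℝ).inter_open_nonempty _ isOpen_interior hJ
  exact hx' (interior_subset hx)

theorem exists_Ioo_subset_of_interior {S : Set ℝ} (h : (interior S).Nonempty) {r : ℝ} (hr : 0 < r) :
    ∃ a b : ℝ, a < b ∧ b - a < r ∧ Ioo a b ⊆ S := by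
  obtain ⟨x, hx⟩ := h
  obtain ⟨ε, hε, h⟩ := Metric.mem_nhds_iff.1 (mem_interior_iff_mem_nhds.1 hx)
  rw [Real.ball_eq_Ioo] at h
  have h1 := min_le_left ε (r / 3)
  have h2 := min_le_right ε (r / 3)
  have h3 : 0 < min ε (r / 3) := lt_min hε (by linarith)
  exact ⟨x - min ε (r / 3), x + min ε (r / 3), by linarith, by linarith,
    (Ioo_subset_Ioo (by linarith) (by linarith)).trans h⟩

variable [T : Tame L]

@[fun_prop] theorem Dfn.hasDerivAt {f : X → ℝ → ℝ} {l t : X → ℝ}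
    (hf : Dfn L (fun q : X × ℝ => f q.1 q.2)) (hl : Dfn L l) (ht : Dfn L t) :
    Dfn L (fun x => HasDerivAt (f x) (l x) (t x)) := by
  simp only [hasDerivAt_iff_forall_exists]; fun_prop

@[fun_prop] theorem Dfn.deriv {f : X → ℝ → ℝ} {t : X → ℝ}
    (hf : Dfn L (fun q : X × ℝ => f q.1 q.2)) (ht : Dfn L t) :
    Dfn L (fun x => deriv (f x) (t x)) := by
  refine dfn_of_graph (p := fun x y => HasDerivAt (f x) y (t x) ∨
    (¬ ∃ l, HasDerivAt (f x) l (t x)) ∧ y = 0) (by fun_prop) fun x y => ⟨?_, ?_⟩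
  · rintro rfl
    by_cases h : DifferentiableAt ℝ (f x) (t x)
    · exact Or.inl h.hasDerivAt
    · exact Or.inr ⟨fun ⟨l, hl⟩ => h hl.differentiableAt, deriv_zero_of_not_differentiableAt h⟩
  · rintro (h | ⟨h, rfl⟩)
    · exact h.deriv
    · exact deriv_zero_of_not_differentiableAt fun hd => h ⟨_, hd.hasDerivAt⟩

theorem differentiableAt_iff_exists {f : ℝ → ℝ} {t : ℝ} :
    DifferentiableAt ℝ f t ↔ ∃ l, HasDerivAt f l t :=
  ⟨fun h => ⟨_, h.hasDerivAt⟩, fun ⟨_, h⟩ => h.differentiableAt⟩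

@[fun_prop] theorem Dfn.differentiableAt {f : X → ℝ → ℝ} {t : X → ℝ}
    (hf : Dfn L (fun q : X × ℝ => f q.1 q.2)) (ht : Dfn L t) :
    Dfn L (fun x => DifferentiableAt ℝ (f x) (t x)) := by
  simp only [differentiableAt_iff_exists]; fun_prop

theorem eventually_nhdsGT_iff {p : ℝ → Prop} {x : ℝ} :
    (∀ᶠ y in 𝓝[>] x, p y) ↔ ∃ u, x < u ∧ ∀ y, x < y → y < u → p y := by
  rw [Filter.Eventually, mem_nhdsGT_iff_exists_Ioo_subset]
  simp only [Set.subset_def, mem_Ioo, and_imp, mem_Ioi]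
  rfl

/-- A definable function whose values do not decrease to the right of each point is monotone on
some interval. -/
theorem exists_monotoneOn {f : ℝ → ℝ} (hf : Dfn L f) {J : Set ℝ} (hJd : Dfn L (fun x => x ∈ J))
    (hJ : (interior J).Nonempty) (h : ∀ x ∈ J, ∀ᶠ y in 𝓝[>] x, f x ≤ f y) :
    ∃ a b : ℝ, a < b ∧ Ioo a b ⊆ J ∧ MonotoneOn f (Ioo a b) := by
  obtain ⟨m, hm⟩ := exists_interior_of_iUnion (L := L)
    (S := fun m : ℕ => {x | x ∈ J ∧ ∀ y, x < y → y < x + 1 / ((m : ℝ) + 1) → f x ≤ f y})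
    (fun m => by simp only [Set.mem_ofPred_eq]; fun_prop) hJ (fun x hx => by
      obtain ⟨u, hu, h⟩ := eventually_nhdsGT_iff.1 (h x hx)
      obtain ⟨m, hm⟩ := exists_nat_one_div_lt (sub_pos.2 hu)
      exact mem_iUnion.2 ⟨m, hx, fun y hy hy' => h _ hy (by linarith)⟩)
  obtain ⟨a, b, hab, hr, h⟩ := exists_Ioo_subset_of_interior hm
    (r := 1 / ((m : ℝ) + 1)) (by positivity)
  refine ⟨a, b, hab, fun x hx => (h hx).1, fun x hx y hy hxy => ?_⟩
  rcases hxy.eq_or_lt with rfl | hxy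
  · exact le_rfl
  · exact (h hx).2 y hxy (by linarith [hx.1, hy.2])

theorem exists_monotoneOn_or_antitoneOn {f : ℝ → ℝ} (hf : Dfn L f) {J : Set ℝ}
    (hJd : Dfn L (fun x => x ∈ J)) (hJ : (interior J).Nonempty) :
    ∃ a b : ℝ, a < b ∧ Ioo a b ⊆ J ∧ (MonotoneOn f (Ioo a b) ∨ AntitoneOn f (Ioo a b)) := by
  let S : Bool → Set ℝ := fun b => {x | x ∈ J ∧
    cond b (∀ᶠ y in 𝓝[>] x, f x ≤ f y) (∀ᶠ y in 𝓝[>] x, -f x ≤ -f y)}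
  have hS : ∀ b, Dfn L (fun x => x ∈ S b) := by
    rintro (_ | _) <;> simp only [S, cond, Set.mem_ofPred_eq, eventually_nhdsGT_iff] <;> fun_prop
  obtain ⟨b, hb⟩ : ∃ b, (interior (S b)).Nonempty := by
    obtain ⟨m, hm⟩ := exists_interior_of_iUnion (L := L) (S := fun m : ℕ => S (m == 0))
      (fun m => hS _) hJ (fun x hx => by
        rcases decidedRight (L := L) (S := {y | f x ≤ f y})
          (by simp only [Set.mem_ofPred_eq]; fun_prop) x with h | h
        · exact mem_iUnion.2 ⟨0, hx, h⟩
        · exact mem_iUnion.2 ⟨1, hx, h.mono fun y hy => neg_le_neg (not_le.1 hy).le⟩)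
    exact ⟨_, hm⟩
  rcases b with _ | _
  · obtain ⟨a, b, hab, hJ, hm⟩ := exists_monotoneOn (f := fun x => - f x) (by fun_prop)
      (hS false) hb fun x hx => hx.2
    exact ⟨a, b, hab, fun x hx => (hJ hx).1, Or.inr fun x hx y hy h => neg_le_neg_iff.1 (hm hx hy h)⟩
  · obtain ⟨a, b, hab, hJ, hm⟩ := exists_monotoneOn hf (hS true) hb fun x hx => hx.2
    exact ⟨a, b, hab, fun x hx => (hJ hx).1, Or.inl hm⟩

theorem MonotoneOn.exists_differentiableAt {f : ℝ → ℝ} {a b : ℝ} (hab : a < b)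
    (h : MonotoneOn f (Ioo a b)) : ∃ x ∈ Ioo a b, DifferentiableAt ℝ f x := by
  by_contra! hne
  have h1 := h.ae_differentiableWithinAt_of_mem
  have h2 : MeasureTheory.volume (Ioo a b) = 0 :=
    MeasureTheory.measure_mono_null (fun x hx (h : x ∈ Ioo a b → DifferentiableWithinAt ℝ f (Ioo a b) x) =>
      hne x hx ((h hx).differentiableAt (isOpen_Ioo.mem_nhds hx))) (MeasureTheory.ae_iff.1 h1)
  rw [Real.volume_Ioo, ENNReal.ofReal_eq_zero, sub_nonpos] at h2
  exact hab.not_ge h2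

/-- A definable function of one variable is differentiable off a finite set. -/
theorem finite_not_differentiableAt {f : ℝ → ℝ} (hf : Dfn L f) :
    {x | ¬ DifferentiableAt ℝ f x}.Finite := by
  have hd : Dfn L (fun x => x ∈ {x | ¬ DifferentiableAt ℝ f x}) := by
    simp only [Set.mem_ofPred_eq]; fun_prop
  by_contra hinf
  obtain ⟨a, b, hab, hJ, hm | hm⟩ :=
    exists_monotoneOn_or_antitoneOn hf hd (interior_nonempty_of_infinite hd hinf)
  · obtain ⟨x, hx, h⟩ := MonotoneOn.exists_differentiableAt hab hm
    exact hJ hx h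
  · obtain ⟨x, hx, h⟩ := MonotoneOn.exists_differentiableAt hab hm.neg
    exact hJ hx (by simpa using h.neg)

/-- The partial derivative in the direction of the `i`-th coordinate. -/
noncomputable def partialDeriv {d : ℕ} (g : (Fin d → ℝ) → ℝ) (i : Fin d) (x : Fin d → ℝ) : ℝ :=
  deriv (fun s => g (Function.update x i s)) (x i)

omit T in
@[fun_prop] theorem Dfn.update {d : ℕ} {f : X → Fin d → ℝ} {g : X → ℝ} (i : Fin d)
    (hf : Dfn L f) (hg : Dfn L g) : Dfn L (fun x => Function.update (f x) i (g x)) := by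
  refine Dfn.pi' fun j => ?_
  by_cases h : j = i
  · subst h; simpa using hg
  · simp only [Function.update_of_ne h]; fun_prop

@[fun_prop] theorem Dfn.partialDeriv {d : ℕ} {g : (Fin d → ℝ) → ℝ} (hg : Dfn L g) (i : Fin d) :
    Dfn L (partialDeriv g i) := by
  unfold Paper.partialDeriv; fun_prop

theorem isMeagre_not_differentiableAt {d : ℕ} {g : (Fin d → ℝ) → ℝ} (hg : Dfn L g) (i : Fin d) :
    IsMeagre {x | ¬ DifferentiableAt ℝ (fun s => g (Function.update x i s)) (x i)} := by
  refine IsNowhereDense.isMeagre (isNowhereDense_of_interior_empty (L := L) (tameTop_pi d)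
    (by simp only [Set.mem_ofPred_eq]; fun_prop) (eq_empty_of_forall_notMem fun x hx => ?_))
  have hfin := finite_not_differentiableAt (L := L) (f := fun s => g (Function.update x i s))
    (by fun_prop)
  have hc : Continuous fun s => Function.update x i s := continuous_const.update i continuous_id
  have hmem : (fun s => Function.update x i s) ⁻¹'
      {x | ¬ DifferentiableAt ℝ (fun s => g (Function.update x i s)) (x i)} ∈ 𝓝 (x i) :=
    hc.continuousAt.preimage_mem_nhds (by simpa using mem_interior_iff_mem_nhds.1 hx)
  refine infinite_of_mem_nhds _ hmem (hfin.subset fun s hs => ?_)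
  simpa using hs

omit T in
/-- A function with continuous partial derivatives is differentiable. -/
theorem hasFDerivAt_of_partial {d : ℕ} {g : (Fin d → ℝ) → ℝ} {G : Fin d → (Fin d → ℝ) → ℝ}
    {x : Fin d → ℝ}
    (hg : ∀ i, ∀ᶠ y in 𝓝 x, HasDerivAt (fun s => g (Function.update y i s)) (G i y) (y i))
    (hG : ∀ i, ContinuousAt (G i) x) :
    HasFDerivAt g (∑ i, G i x • ContinuousLinearMap.proj (R := ℝ) (φ := fun _ : Fin d => ℝ) i) x := by
  rw [hasFDerivAt_iff_isLittleO, Asymptotics.isLittleO_iff]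
  intro c hc
  obtain ⟨ε, hε, hεc⟩ : ∃ ε : ℝ, 0 < ε ∧ d * ε ≤ c :=
    ⟨c / (d + 1), by positivity, by
      rw [← mul_div_assoc, div_le_iff₀ (by positivity)]; nlinarith⟩
  have h1 : ∀ᶠ y in 𝓝 x, ∀ i, HasDerivAt (fun s => g (Function.update y i s)) (G i y) (y i) ∧
      |G i y - G i x| ≤ ε :=
    Filter.eventually_all.2 fun i => (hg i).and
      ((Metric.tendsto_nhds.1 (hG i) ε hε).mono fun y hy => (Real.dist_eq _ _ ▸ hy).le)
  obtain ⟨δ, hδ, h1⟩ := Metric.eventually_nhds_iff.1 h1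
  filter_upwards [Metric.ball_mem_nhds x hδ] with y hy
  let z : ℕ → Fin d → ℝ := fun k i => if (i : ℕ) < k then y i else x i
  rw [Metric.mem_ball, dist_pi_lt_iff hδ] at hy
  have hz : ∀ k i s, s ∈ uIcc (x i) (y i) → dist (Function.update (z k) i s) x < δ := by
    intro k i s hs
    rw [dist_pi_lt_iff hδ]
    intro j
    by_cases hj : j = i
    · subst hj
      rw [Function.update_self]
      refine lt_of_le_of_lt ?_ (hy j)
      rw [Real.dist_eq, Real.dist_eq]
      exact abs_sub_left_of_mem_uIcc hs
    · rw [Function.update_of_ne hj]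
      by_cases h : (j : ℕ) < k <;> simp [z, h, hy j, hδ]
  have hstep : ∀ i : Fin d, |g (z (i + 1)) - g (z i) - G i x * (y i - x i)| ≤ ε * |y i - x i| := by
    intro i
    have e0 : z i = Function.update (z i) i (x i) := by
      rw [eq_comm, Function.update_eq_self_iff]; simp [z]
    have e1 : z (i + 1) = Function.update (z i) i (y i) := by
      ext j
      by_cases hj : j = i
      · subst hj; simp [z]
      · have : (j : ℕ) ≠ i := fun h => hj (Fin.ext h)
        rw [Function.update_of_ne hj]
        simp only [z]
        congr 1
        simp only [eq_iff_iff]; omega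
    have hd : ∀ s ∈ uIcc (x i) (y i), HasDerivWithinAt
        (fun s => g (Function.update (z i) i s) - G i x * s)
        (G i (Function.update (z i) i s) - G i x) (uIcc (x i) (y i)) s := by
      intro s hs
      have h2 := (h1 (hz i i s hs) i).1
      simp only [Function.update_idem, Function.update_self] at h2
      have h3 := (hasDerivAt_id s).const_mul (G i x)
      rw [mul_one] at h3
      exact (h2.sub h3).hasDerivWithinAt
    have := (convex_uIcc (x i) (y i)).norm_image_sub_le_of_norm_hasDerivWithin_le (C := ε) hd
      (fun s hs => (h1 (hz i i s hs) i).2) left_mem_uIcc right_mem_uIcc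
    rw [Real.norm_eq_abs, Real.norm_eq_abs] at this
    rw [e1, e0, Function.update_idem]
    convert this using 2
    rw [← e0]
    ring
  have hz0 : z 0 = x := by ext i; simp [z]
  have hzd : z d = y := by ext i; simp [z]
  have hsum : g y - g x = ∑ i : Fin d, (g (z (i + 1)) - g (z i)) := by
    rw [Fin.sum_univ_eq_sum_range (fun k => g (z (k + 1)) - g (z k)) d, Finset.sum_range_sub (fun k => g (z k)),
      hz0, hzd]
  have : g y - g x - (∑ i, G i x • ContinuousLinearMap.proj (R := ℝ) (φ := fun _ : Fin d => ℝ) i)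
      (y - x) = ∑ i : Fin d, (g (z (i + 1)) - g (z i) - G i x * (y i - x i)) := by
    rw [hsum, Finset.sum_sub_distrib]
    simp
  rw [this]
  calc ‖_‖ ≤ ∑ i : Fin d, ε * ‖y - x‖ := by
        refine norm_sum_le_of_le _ fun i _ => (hstep i).trans ?_
        gcongr
        exact norm_le_pi_norm (y - x) i
    _ = d * ε * ‖y - x‖ := by simp; ring
    _ ≤ c * ‖y - x‖ := by gcongr

end Differentiability

section Flattening

variable {L}
variable [T : Tame L]

theorem eventually_differentiableAt {q : ℝ → ℝ} (hq : Dfn L q) :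
    ∀ᶠ t in 𝓝[>] (0 : ℝ), DifferentiableAt ℝ q t := by
  refine (decidedRight (L := L) (S := {t | DifferentiableAt ℝ q t})
    (by simp only [Set.mem_ofPred_eq]; fun_prop) 0).resolve_right fun h => ?_
  obtain ⟨u, hu, h⟩ := eventually_nhdsGT_iff.1 h
  exact Ioo_infinite hu ((finite_not_differentiableAt hq).subset fun t ht => h t ht.1 ht.2)

omit T in
theorem not_eventually_one_lt_mul_deriv {q : ℝ → ℝ} {C : ℝ}
    (hd : ∀ᶠ t in 𝓝[>] (0 : ℝ), DifferentiableAt ℝ q t)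
    (hC : ∀ᶠ t in 𝓝[>] (0 : ℝ), |q t| ≤ C) :
    ¬ ∀ᶠ t in 𝓝[>] (0 : ℝ), 1 < t * deriv q t := by
  intro h
  obtain ⟨u, hu, hall⟩ := eventually_nhdsGT_iff.1 ((hd.and hC).and h)
  have hmono : MonotoneOn (fun t => q t - Real.log t) (Ioo 0 u) := by
    have hder : ∀ t ∈ Ioo 0 u, HasDerivAt (fun t => q t - Real.log t) (deriv q t - t⁻¹) t :=
      fun t ht => (hall t ht.1 ht.2).1.1.hasDerivAt.sub (Real.hasDerivAt_log ht.1.ne')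
    refine monotoneOn_of_deriv_nonneg (convex_Ioo _ _)
      (fun t ht => (hder t ht).continuousAt.continuousWithinAt)
      (fun t ht => ?_) fun t ht => ?_ <;> rw [interior_Ioo] at ht
    · exact (hder t ht).differentiableAt.differentiableWithinAt
    · rw [(hder t ht).deriv, sub_nonneg, inv_le_iff_one_le_mul₀ ht.1, mul_comm]
      exact (hall t ht.1 ht.2).2.le
  have hlog : ∀ᶠ t in 𝓝[>] (0 : ℝ), Real.log t < Real.log (u / 2) - 2 * C :=
    Real.tendsto_log_nhdsGT_zero.eventually (Filter.eventually_lt_atBot _)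
  obtain ⟨t, ht, ht'⟩ := (hlog.and (Ioo_mem_nhdsGT (half_pos hu))).exists
  have h1 := hmono ⟨ht'.1, by linarith [ht'.2]⟩ ⟨half_pos hu, half_lt_self hu⟩ ht'.2.le
  have h2 := abs_le.1 (hall t ht'.1 (by linarith [ht'.2])).1.2
  have h3 := abs_le.1 (hall (u / 2) (half_pos hu) (half_lt_self hu)).1.2
  simp only at h1
  linarith [h2.1, h3.2]

/-- A bounded definable function `q` satisfies `|t q'(t)| ≤ 1` near `0`. -/
theorem eventually_mul_deriv_le {q : ℝ → ℝ} (hq : Dfn L q) {C : ℝ}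
    (hC : ∀ᶠ t in 𝓝[>] (0 : ℝ), |q t| ≤ C) : ∀ᶠ t in 𝓝[>] (0 : ℝ), |t * deriv q t| ≤ 1 := by
  have h1 := eventually_differentiableAt hq
  have h2 := (decidedRight (L := L) (S := {t | 1 < t * deriv q t})
    (by simp only [Set.mem_ofPred_eq]; fun_prop) 0).resolve_left
    (not_eventually_one_lt_mul_deriv h1 hC)
  have h3 := (decidedRight (L := L) (S := {t | 1 < t * deriv (fun t => - q t) t})
    (by simp only [Set.mem_ofPred_eq]; fun_prop) 0).resolve_left
    (not_eventually_one_lt_mul_deriv (h1.mono fun t h => h.neg) (by simpa using hC))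
  filter_upwards [h2, h3] with t h2 h3
  rw [deriv.fun_neg] at h3
  simp only [not_lt] at h2 h3
  exact abs_le.2 ⟨by linarith, h2⟩

/-- Products of powers of `t` and of a small definable function `v` have derivatives of all orders
dominated by `t² v`. -/
theorem exists_derivative_chain {v : ℝ → ℝ} (hv : Dfn L v) (hv0 : ∀ t, 0 < v t)
    (hv1 : ∀ t, v t ≤ 1) : ∀ (R a b : ℕ) (q : ℝ → ℝ) (C : ℝ), Dfn L q →
    (∀ᶠ t in 𝓝[>] (0 : ℝ), |q t| ≤ C) →
    ∃ Φ : ℕ → ℝ → ℝ, Φ 0 = (fun t => t ^ (a + R + 3) * v t ^ (b + R + 1) * q t) ∧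
      ∀ᶠ t in 𝓝[>] (0 : ℝ), ∀ j ≤ R, HasDerivAt (Φ j) (Φ (j + 1) t) t ∧ |Φ j t| ≤ t ^ 2 * v t := by
  intro R
  have hbound : ∀ (a b : ℕ) (q : ℝ → ℝ) (C : ℝ), (∀ᶠ t in 𝓝[>] (0 : ℝ), |q t| ≤ C) →
      ∀ᶠ t in 𝓝[>] (0 : ℝ), |t ^ (a + 3) * v t ^ (b + 1) * q t| ≤ t ^ 2 * v t := by
    intro a b q C hC
    have h1 : ∀ᶠ t in 𝓝[>] (0 : ℝ), t < 1 ∧ t * (|C| + 1) < 1 := by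
      have : ∀ᶠ t in 𝓝 (0 : ℝ), t < 1 ∧ t * (|C| + 1) < 1 :=
        (continuousAt_id.eventually (gt_mem_nhds one_pos)).and
          ((continuous_mul_const (|C| + 1)).continuousAt.eventually (gt_mem_nhds (by simp)))
      exact this.filter_mono nhdsWithin_le_nhds
    filter_upwards [hC, h1, self_mem_nhdsWithin] with t hC h1 ht
    have ht : 0 < t := ht
    have hv := hv0 t
    have e1 : t ^ a ≤ 1 := pow_le_one₀ ht.le h1.1.le
    have e2 : v t ^ b ≤ 1 := pow_le_one₀ hv.le (hv1 t)
    have e3 : t * |q t| ≤ 1 := by nlinarith [le_abs_self C, abs_nonneg (q t)]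
    rw [abs_mul, abs_of_pos (by positivity)]
    calc t ^ (a + 3) * v t ^ (b + 1) * |q t|
        = (t ^ 2 * v t) * ((t ^ a * v t ^ b) * (t * |q t|)) := by ring
      _ ≤ (t ^ 2 * v t) * ((1 * 1) * 1) := by gcongr
      _ = _ := by ring
  have hvC : ∀ᶠ t in 𝓝[>] (0 : ℝ), |v t| ≤ 1 :=
    Filter.Eventually.of_forall fun t => by rw [abs_of_pos (hv0 t)]; exact hv1 t
  have hvd := eventually_differentiableAt hv
  have hvb := eventually_mul_deriv_le hv hvC
  have hder : ∀ (a b : ℕ) (q : ℝ → ℝ), Dfn L q → ∀ᶠ t in 𝓝[>] (0 : ℝ),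
      HasDerivAt (fun t => t ^ (a + 1) * v t ^ (b + 1) * q t)
        (t ^ a * v t ^ b * ((a + 1) * (v t * q t) + (b + 1) * (t * deriv v t) * q t +
          v t * (t * deriv q t))) t := by
    intro a b q hq
    filter_upwards [hvd, eventually_differentiableAt hq] with t h1 h2
    have := ((hasDerivAt_pow (a + 1) t).mul (h1.hasDerivAt.pow (b + 1))).mul h2.hasDerivAt
    refine this.congr_deriv ?_
    simp only [Nat.add_sub_cancel, Pi.mul_apply, Pi.pow_apply]
    push_cast
    ring
  induction R with
  | zero =>
    intro a b q C hq hC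
    refine ⟨fun j => Nat.casesOn j (fun t => t ^ (a + 0 + 3) * v t ^ (b + 0 + 1) * q t) fun _ t => 
      t ^ (a + 2) * v t ^ b * (((a + 2 : ℕ) + 1) * (v t * q t) + (b + 1) * (t * deriv v t) * q t +
          v t * (t * deriv q t)), rfl, ?_⟩
    filter_upwards [hbound a b q C hC, hder (a + 2) b q hq] with t h1 h2 j hj
    obtain rfl : j = 0 := by omega
    exact ⟨h2, h1⟩
  | succ R ih =>
    intro a b q C hq hC
    have hqb := eventually_mul_deriv_le hq hC
    set q' : ℝ → ℝ := fun t => ((a + R + 3 : ℕ) + 1) * (v t * q t) +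
      ((b + R + 1 : ℕ) + 1) * (t * deriv v t) * q t + v t * (t * deriv q t) with hq'
    obtain ⟨Φ, hΦ0, hΦ⟩ := ih a b q' (((a + R + 3 : ℕ) + 1) * (1 * C) +
      ((b + R + 1 : ℕ) + 1) * 1 * C + 1 * 1) (by fun_prop) (by
        filter_upwards [hC, hqb, hvC, hvb] with t h1 h2 h3 h4
        refine (abs_add_le _ _).trans (add_le_add ((abs_add_le _ _).trans (add_le_add ?_ ?_)) ?_)
        · rw [abs_mul, abs_mul, abs_of_nonneg (by positivity)]; gcongr
        · rw [abs_mul, abs_mul, abs_of_nonneg (by positivity : (0 : ℝ) ≤ (b + R + 1 : ℕ) + 1)]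
          gcongr
        · rw [abs_mul]; gcongr)
    refine ⟨fun j => Nat.casesOn j
      (fun t => t ^ (a + (R + 1) + 3) * v t ^ (b + (R + 1) + 1) * q t) Φ, rfl, ?_⟩
    filter_upwards [hbound (a + (R + 1)) (b + (R + 1)) q C hC,
      hder (a + R + 3) (b + R + 1) q hq, hΦ] with t h1 h2 h3 j hj
    rcases j with _ | j
    · refine ⟨?_, h1⟩
      rw [hΦ0]
      exact h2
    · exact h3 j (by omega)

/-- For each definable `s` there is a positive definable function near `0` whose derivatives up to
order `R` are dominated by `t² / (1 + s)`. -/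
theorem exists_flat {s : ℝ → ℝ} (hs : Dfn L s) (R : ℕ) :
    ∃ δ : ℝ, 0 < δ ∧ ∃ Φ : ℕ → ℝ → ℝ, Dfn L (Φ 0) ∧ (∀ t ∈ Ioo 0 δ, 0 < Φ 0 t) ∧
      ∀ t ∈ Ioo 0 δ, ∀ j ≤ R, HasDerivAt (Φ j) (Φ (j + 1) t) t ∧ |Φ j t| * |s t| ≤ t ^ 2 := by
  have hp : ∀ t, 0 < 1 + |s t| := fun t => by positivity
  obtain ⟨Φ, h0, h⟩ := exists_derivative_chain (L := L) (v := fun t => 1 / (1 + |s t|))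
    (by fun_prop) (fun t => by have := hp t; positivity)
    (fun t => (div_le_one (hp t)).2 (by linarith [abs_nonneg (s t)])) R 0 0 (fun _ => 1) 1
    (by fun_prop) (by simp)
  obtain ⟨δ, hδ, h⟩ := eventually_nhdsGT_iff.1 h
  refine ⟨δ, hδ, Φ, by rw [h0]; fun_prop, fun t ht => ?_, fun t ht j hj => ?_⟩
  · have := hp t
    have := ht.1
    rw [h0]; positivity
  · obtain ⟨h1, h2⟩ := h t ht.1 ht.2 j hj
    refine ⟨h1, ?_⟩
    rw [mul_one_div, le_div_iff₀ (hp t)] at h2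
    nlinarith [abs_nonneg (Φ j t)]

end Flattening

section FlatMultiplier

variable {L}

/-- The linear form with coefficients `c`. -/
noncomputable def linForm {d : ℕ} (c : Fin d → ℝ) : (Fin d → ℝ) →L[ℝ] ℝ :=
  ∑ i, c i • ContinuousLinearMap.proj (R := ℝ) (φ := fun _ : Fin d => ℝ) i

theorem linForm_apply_single {d : ℕ} (A : (Fin d → ℝ) →L[ℝ] ℝ) :
    linForm (fun i => A (Pi.single i 1)) = A := by
  ext x
  simp only [linForm, sum_apply, smul_apply,
    ContinuousLinearMap.proj_apply, smul_eq_mul]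
  conv_rhs => rw [pi_eq_sum_univ' x, map_sum]
  refine Finset.sum_congr rfl fun i _ => ?_
  rw [map_smul, smul_eq_mul, mul_comm]

theorem contDiff_linForm {d r : ℕ} {G : Fin d → (Fin d → ℝ) → ℝ} (hG : ∀ i, ContDiff ℝ r (G i)) :
    ContDiff ℝ r fun x => linForm fun i => G i x :=
  ContDiff.sum fun i _ => (hG i).smul contDiff_const

/-- `g` is of class `C^r` on `W` with partial derivatives up to order `r` bounded by `M`. -/
def CrBound {d : ℕ} (W : Set (Fin d → ℝ)) :
    ℕ → ((Fin d → ℝ) → ℝ) → ((Fin d → ℝ) → ℝ) → Prop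
  | 0, g, M => ContinuousOn g W ∧ ∀ x ∈ W, |g x| ≤ M x
  | r + 1, g, M => (∀ x ∈ W, |g x| ≤ M x) ∧ ∃ G : Fin d → (Fin d → ℝ) → ℝ,
      (∀ x ∈ W, HasFDerivAt g (linForm fun i => G i x) x) ∧ ∀ i, CrBound W r (G i) M

theorem CrBound.mono {d : ℕ} {W W' : Set (Fin d → ℝ)} {M M' : (Fin d → ℝ) → ℝ} (hW : W' ⊆ W)
    (hM : ∀ x ∈ W', M x ≤ M' x) : ∀ {r : ℕ} {g : (Fin d → ℝ) → ℝ},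
    CrBound W r g M → CrBound W' r g M'
  | 0, _, h => ⟨h.1.mono hW, fun x hx => (h.2 x (hW hx)).trans (hM x hx)⟩
  | _ + 1, _, ⟨h1, G, hG, hG'⟩ => ⟨fun x hx => (h1 x (hW hx)).trans (hM x hx), G,
      fun x hx => hG x (hW hx), fun i => (hG' i).mono hW hM⟩

theorem CrBound.bound {d : ℕ} {W : Set (Fin d → ℝ)} {M : (Fin d → ℝ) → ℝ} :
    ∀ {r : ℕ} {g : (Fin d → ℝ) → ℝ}, CrBound W r g M → ∀ x ∈ W, |g x| ≤ M x
  | 0, _, h => h.2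
  | _ + 1, _, h => h.1

theorem CrBound.continuousOn {d : ℕ} {W : Set (Fin d → ℝ)} {M : (Fin d → ℝ) → ℝ} :
    ∀ {r : ℕ} {g : (Fin d → ℝ) → ℝ}, CrBound W r g M → ContinuousOn g W
  | 0, _, h => h.1
  | _ + 1, _, ⟨_, _, hG, _⟩ => fun x hx => (hG x hx).continuousAt.continuousWithinAt

theorem CrBound.of_succ {d : ℕ} {W : Set (Fin d → ℝ)} {M : (Fin d → ℝ) → ℝ} :
    ∀ {r : ℕ} {g : (Fin d → ℝ) → ℝ}, CrBound W (r + 1) g M → CrBound W r g M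
  | 0, _, h => ⟨h.continuousOn, h.bound⟩
  | _ + 1, _, ⟨h, G, hG, hG'⟩ => ⟨h, G, hG, fun i => (hG' i).of_succ⟩

theorem CrBound.const {d : ℕ} {W : Set (Fin d → ℝ)} {M : (Fin d → ℝ) → ℝ} {c : ℝ}
    (h0 : ∀ x ∈ W, 0 ≤ M x) (h : ∀ x ∈ W, |c| ≤ M x) : ∀ {r : ℕ}, CrBound W r (fun _ => c) M
  | 0 => ⟨continuousOn_const, h⟩
  | r + 1 => ⟨h, fun _ _ => 0, fun x _ => by simpa [linForm] using hasFDerivAt_const c x,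
      fun _ => CrBound.const h0 (by simpa using h0)⟩

/-- Definable functions are generically of class `C^r`. -/
theorem exists_crBound [T : Tame L] {d : ℕ} : ∀ (r : ℕ) {g : (Fin d → ℝ) → ℝ}, Dfn L g →
    ∃ (W : Set (Fin d → ℝ)) (M : (Fin d → ℝ) → ℝ), Generic L W ∧ Dfn L M ∧ ContinuousOn M W ∧
      CrBound W r g M
  | 0, g, hg => by
    have h : ContinuousOn g (interior {x | ContinuousAt g x}) :=
      fun x hx => (interior_subset hx : ContinuousAt g x).continuousWithinAt
    exact ⟨_, fun x => |g x|, generic_continuousAt hg, by fun_prop, h.abs, h, fun x _ => le_rfl⟩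
  | r + 1, g, hg => by
    have hG : ∀ i, Dfn L (partialDeriv g i) := fun i => by fun_prop
    choose W M hW hM hMc hB using fun i => exists_crBound r (hG i)
    have h1 : Generic L (interior {x | ∀ i,
        DifferentiableAt ℝ (fun s => g (Function.update x i s)) (x i)}) := by
      refine Generic.interior_of_isMeagre
        ((isMeagre_iUnion fun i => isMeagre_not_differentiableAt hg i).mono fun x hx => ?_)
        (by simp only [Set.mem_ofPred_eq]; fun_prop)
      simpa using hx
    set V := interior {x | ∀ i, DifferentiableAt ℝ (fun s => g (Function.update x i s)) (x i)}
    have hWo : IsOpen (V ∩ ⋂ i, W i) := (h1.inter (Generic.iInter hW)).isOpen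
    have hder : ∀ x ∈ V ∩ ⋂ i, W i, HasFDerivAt g (linForm fun i => partialDeriv g i x) x := by
      intro x hx
      have hx' := fun i => mem_iInter.1 hx.2 i
      refine hasFDerivAt_of_partial (fun i => ?_) fun i =>
        (hB i).continuousOn.continuousAt ((hW i).isOpen.mem_nhds (hx' i))
      filter_upwards [h1.isOpen.mem_nhds hx.1] with y hy
      exact (interior_subset hy i).hasDerivAt
    have hgc : ContinuousOn g (V ∩ ⋂ i, W i) :=
      fun x hx => (hder x hx).continuousAt.continuousWithinAt
    have hsub : ∀ i, V ∩ ⋂ i, W i ⊆ W i := fun i => inter_subset_right.trans (iInter_subset W i)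
    refine ⟨V ∩ ⋂ i, W i, fun x => |g x| + ∑ i, |M i x|, h1.inter (Generic.iInter hW),
      by fun_prop, ?_, fun x hx => ?_, fun i => partialDeriv g i, hder, fun i => ?_⟩
    · exact hgc.abs.add (continuousOn_finsetSum _ fun i _ => ((hMc i).mono (hsub i)).abs)
    · have : 0 ≤ ∑ i, |M i x| := Finset.sum_nonneg fun i _ => abs_nonneg _
      linarith
    · refine (hB i).mono (hsub i) fun x _ => ?_
      have h2 : |M i x| ≤ ∑ i, |M i x| :=
        Finset.single_le_sum (f := fun i => |M i x|) (fun _ _ => abs_nonneg _) (Finset.mem_univ i)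
      linarith [le_abs_self (M i x), abs_nonneg (g x)]

open Classical in
/-- Extension by zero of a function on `W`. -/
noncomputable def zeroExt {d : ℕ} (W : Set (Fin d → ℝ)) (h : (Fin d → ℝ) → ℝ) (x : Fin d → ℝ) : ℝ :=
  if x ∈ W then h x else 0

theorem zeroExt_of_mem {d : ℕ} {W : Set (Fin d → ℝ)} {h : (Fin d → ℝ) → ℝ} {x : Fin d → ℝ}
    (hx : x ∈ W) : zeroExt W h x = h x := if_pos hx

theorem zeroExt_of_notMem {d : ℕ} {W : Set (Fin d → ℝ)} {h : (Fin d → ℝ) → ℝ} {x : Fin d → ℝ}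
    (hx : x ∉ W) : zeroExt W h x = 0 := if_neg hx

/-- Multiplying a `C^r` function on `W` by a function which is flat enough along the boundary
yields a `C^r` function everywhere. -/
theorem contDiff_zeroExt {d : ℕ} {W : Set (Fin d → ℝ)} (hW : IsOpen W) {M τ : (Fin d → ℝ) → ℝ}
    {I : Set ℝ} (hτI : ∀ x ∈ W, τ x ∈ I) (hτ0 : ∀ x, x ∉ W → τ x = 0) :
    ∀ (r : ℕ) (Φ : ℕ → ℝ → ℝ) (g : (Fin d → ℝ) → ℝ), ContDiff ℝ r τ →
    (∀ t ∈ I, ∀ j ≤ r, HasDerivAt (Φ j) (Φ (j + 1) t) t) →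
    (∀ a, a ∉ W → ∀ᶠ x in 𝓝 a, x ∈ W → ∀ j ≤ r, |Φ j (τ x)| * M x ≤ τ x ^ 2) →
    CrBound W r g M → ContDiff ℝ r (zeroExt W fun x => Φ 0 (τ x) * g x) := by
  have hbound : ∀ {r : ℕ} {Φ : ℕ → ℝ → ℝ} {g : (Fin d → ℝ) → ℝ},
      (∀ a, a ∉ W → ∀ᶠ x in 𝓝 a, x ∈ W → ∀ j ≤ r, |Φ j (τ x)| * M x ≤ τ x ^ 2) →
      CrBound W r g M → ∀ a, a ∉ W → ∀ᶠ x in 𝓝 a,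
        |zeroExt W (fun x => Φ 0 (τ x) * g x) x| ≤ τ x ^ 2 := by
    intro r Φ g hΦ hg a ha
    filter_upwards [hΦ a ha] with x hx
    by_cases hxW : x ∈ W
    · rw [zeroExt_of_mem hxW, abs_mul]
      exact (mul_le_mul_of_nonneg_left (hg.bound x hxW) (abs_nonneg _)).trans
        (hx hxW 0 (Nat.zero_le _))
    · rw [zeroExt_of_notMem hxW, abs_zero]
      positivity
  have hev : ∀ (h : (Fin d → ℝ) → ℝ), ∀ a ∈ W, zeroExt W h =ᶠ[𝓝 a] h := fun h a ha => by
    filter_upwards [hW.mem_nhds ha] with x hx using zeroExt_of_mem hx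
  intro r
  induction r with
  | zero =>
    intro Φ g hτ hder hΦ hg
    have hτc : Continuous τ := hτ.continuous
    refine contDiff_zero.2 (continuous_iff_continuousAt.2 fun a => ?_)
    by_cases ha : a ∈ W
    · refine ContinuousAt.congr ?_ (hev _ a ha).symm
      exact (ContinuousAt.comp (f := τ) (hder _ (hτI a ha) 0 le_rfl).continuousAt
        hτc.continuousAt).mul (hg.continuousOn.continuousAt (hW.mem_nhds ha))
    · have h0 : Filter.Tendsto (fun x => τ x ^ 2) (𝓝 a) (𝓝 0) := by
        have : Filter.Tendsto (fun x => τ x ^ 2) (𝓝 a) (𝓝 (τ a ^ 2)) := (hτc.pow 2).tendsto a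
        rwa [hτ0 a ha, zero_pow two_ne_zero] at this
      rw [ContinuousAt, zeroExt_of_notMem ha]
      exact squeeze_zero_norm' (hbound hΦ hg a ha) h0
  | succ r ih =>
    intro Φ g hτ hder hΦ hg
    obtain ⟨hb, G, hG, hG'⟩ := id hg
    have h1 := ih (fun j => Φ (j + 1)) g (hτ.of_le (by exact_mod_cast r.le_succ))
      (fun t ht j hj => hder t ht (j + 1) (by lia))
      (fun a ha => (hΦ a ha).mono fun x hx hxW j hj => hx hxW (j + 1) (by lia)) hg.of_succ
    have h2 := fun i => ih Φ (G i) (hτ.of_le (by exact_mod_cast r.le_succ))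
      (fun t ht j hj => hder t ht j (by lia))
      (fun a ha => (hΦ a ha).mono fun x hx hxW j hj => hx hxW j (by lia)) (hG' i)
    have h3 : ∀ i, ContDiff ℝ r fun x => fderiv ℝ τ x (Pi.single i 1) := fun i =>
      (hτ.fderiv_right (m := r) (by norm_cast)).clm_apply contDiff_const
    have hτd : Differentiable ℝ τ := hτ.differentiable (by norm_cast)
    rw [Nat.cast_succ, contDiff_succ_iff_hasFDerivAt]
    refine ⟨_, contDiff_linForm fun i => (h1.mul (h3 i)).add (h2 i), fun a => ?_⟩
    by_cases ha : a ∈ W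
    · refine HasFDerivAt.congr_of_eventuallyEq ?_ (hev _ a ha)
      have h4 := ((hder _ (hτI a ha) 0 (Nat.zero_le _)).comp_hasFDerivAt a
        (hτd a).hasFDerivAt).mul (hG a ha)
      refine h4.congr_fderiv ?_
      ext x
      simp only [linForm, zeroExt_of_mem ha]
      conv_lhs => rw [← linForm_apply_single (fderiv ℝ τ a)]
      simp [linForm, Finset.mul_sum, ← Finset.sum_add_distrib]
      refine Finset.sum_congr rfl fun i _ => by ring
    · have h5 : HasFDerivAt (fun x => τ x ^ 2) (0 : (Fin d → ℝ) →L[ℝ] ℝ) a := by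
        have := (hτd a).hasFDerivAt.pow 2
        simpa [hτ0 a ha] using this
      have h6 : (linForm fun i => zeroExt W (fun x => Φ (0 + 1) (τ x) * g x) a *
          fderiv ℝ τ a (Pi.single i 1) + zeroExt W (fun x => Φ 0 (τ x) * G i x) a) = 0 := by
        simp [linForm, zeroExt_of_notMem ha]
      rw [h6]
      rw [hasFDerivAt_iff_isLittleO] at h5 ⊢
      refine Asymptotics.IsBigO.trans_isLittleO (Asymptotics.IsBigO.of_bound 1 ?_) h5
      filter_upwards [hbound hΦ hg a ha] with x hx
      simpa [zeroExt_of_notMem ha, hτ0 a ha] using hx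

end FlatMultiplier

section CarvedSets

variable {L}

variable (L) in
/-- Every definable open subset of `ℝ^d` is the set where some nonnegative definable `C^r`
function is positive. -/
def OpenCarved (r d : ℕ) : Prop :=
  ∀ U : Set (Fin d → ℝ), IsOpen U → Dfn L (fun x => x ∈ U) →
    ∃ F : (Fin d → ℝ) → ℝ, Dfn L F ∧ ContDiff ℝ r F ∧ ∀ x, 0 ≤ F x ∧ (0 < F x ↔ x ∈ U)

theorem exists_flatMultiplier [T : Tame L] {r d : ℕ} (hT : OpenCarved L r d)
    {ι : Type} [Fintype ι] {g : ι → (Fin d → ℝ) → ℝ} (hg : ∀ i, Dfn L (g i)) :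
    ∃ (W : Set (Fin d → ℝ)) (μ : (Fin d → ℝ) → ℝ), Generic L W ∧ Dfn L μ ∧ ContDiff ℝ r μ ∧
      (∀ x, 0 ≤ μ x ∧ (0 < μ x ↔ x ∈ W)) ∧ ∀ i, ContDiff ℝ r fun x => μ x * g i x := by
  choose W' M' hW' hM' hMc' hB' using fun i => exists_crBound r (hg i)
  set W := ⋂ i, W' i
  have hW : Generic L W := Generic.iInter hW'
  have hWd := hW.dfn
  have hsub : ∀ i, W ⊆ W' i := iInter_subset W'
  set M : (Fin d → ℝ) → ℝ := fun x => 1 + ∑ i, |M' i x| with hM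
  have hM1 : ∀ x, 1 ≤ M x := fun x => by
    have : 0 ≤ ∑ i, |M' i x| := Finset.sum_nonneg fun i _ => abs_nonneg _
    simp only [hM]; linarith
  have hMd : Dfn L M := by fun_prop
  have hMc : ContinuousOn M W := continuousOn_const.add
    (continuousOn_finsetSum _ fun i _ => ((hMc' i).mono (hsub i)).abs)
  have hB : ∀ i, CrBound W r (g i) M := fun i => (hB' i).mono (hsub i) fun x _ => by
    have : |M' i x| ≤ ∑ i, |M' i x| :=
      Finset.single_le_sum (f := fun i => |M' i x|) (fun _ _ => abs_nonneg _) (Finset.mem_univ i)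
    simp only [hM]; linarith [le_abs_self (M' i x)]
  obtain ⟨ε, hεd, hεc, hε⟩ := hT W hW.isOpen hWd
  set s : ℝ → ℝ := fun t => sSup {m | ∃ x, t ≤ ε x ∧ (∀ i, t * |x i| ≤ 1) ∧ M x = m} with hs
  have hsd : Dfn L s := by fun_prop
  obtain ⟨δ, hδ, Φ, hΦd, hΦpos, hΦ⟩ := exists_flat hsd r
  set τ : (Fin d → ℝ) → ℝ := fun x => min δ 1 * (ε x / (1 + ε x)) with hτ
  have hε1 : ∀ x, 0 < 1 + ε x := fun x => by linarith [(hε x).1]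
  have hτd : Dfn L τ := by fun_prop
  have hτc : ContDiff ℝ r τ :=
    contDiff_const.mul (hεc.div (contDiff_const.add hεc) fun x => (hε1 x).ne')
  have hm : 0 < min δ 1 := lt_min hδ one_pos
  have hτε : ∀ x, τ x ≤ ε x := fun x => by
    have h1 : ε x / (1 + ε x) ≤ ε x := div_le_self (hε x).1 (by linarith [(hε x).1])
    have h2 : 0 ≤ ε x / (1 + ε x) := div_nonneg (hε x).1 (hε1 x).le
    exact (mul_le_of_le_one_left h2 (min_le_right _ _)).trans h1
  have hτI : ∀ x ∈ W, τ x ∈ Ioo 0 δ := fun x hx => by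
    have h1 := (hε x).2.2 hx
    refine ⟨mul_pos hm (div_pos h1 (hε1 x)), ?_⟩
    have h2 : ε x / (1 + ε x) < 1 := (div_lt_one (hε1 x)).2 (by linarith)
    exact (mul_lt_of_lt_one_right hm h2).trans_le (min_le_left _ _)
  have hτ0 : ∀ x, x ∉ W → τ x = 0 := fun x hx => by
    have : ε x = 0 := le_antisymm (not_lt.1 fun h => hx ((hε x).2.1 h)) (hε x).1
    simp [hτ, this]
  have hMs : ∀ x ∈ W, τ x * ‖x‖ ≤ 1 → M x ≤ s (τ x) := by
    intro x hx hx1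
    have ht := (hτI x hx).1
    have hle : ∀ {y : Fin d → ℝ} {i}, τ x * |y i| ≤ τ x * ‖y‖ := fun {y i} =>
      mul_le_mul_of_nonneg_left (norm_le_pi_norm y i) ht.le
    refine le_csSup ?_ ⟨x, hτε x, fun i => hle.trans hx1, rfl⟩
    have hK : IsCompact ({y | τ x ≤ ε y} ∩ Metric.closedBall (0 : Fin d → ℝ) (1 / τ x)) :=
      (isCompact_closedBall _ _).inter_left (isClosed_le continuous_const hεc.continuous)
    refine (hK.bddAbove_image (f := M) (hMc.mono fun y hy => (hε y).2.1 (ht.trans_le hy.1))).mono ?_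
    rintro m ⟨y, hy1, hy2, rfl⟩
    refine ⟨y, ⟨hy1, ?_⟩, rfl⟩
    rw [mem_closedBall_zero_iff, pi_norm_le_iff_of_nonneg (by positivity)]
    intro i
    rw [le_div_iff₀ ht, mul_comm]
    exact hy2 i
  have hflat : ∀ a, a ∉ W → ∀ᶠ x in 𝓝 a, x ∈ W → ∀ j ≤ r, |Φ j (τ x)| * M x ≤ τ x ^ 2 := by
    intro a ha
    have h1 : ∀ᶠ x in 𝓝 a, τ x * ‖x‖ < 1 := by
      refine (hτc.continuous.mul continuous_norm).continuousAt.eventually_lt continuousAt_const ?_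
      simp [hτ0 a ha]
    filter_upwards [h1] with x hx hxW j hj
    refine le_trans ?_ (hΦ _ (hτI x hxW) j hj).2
    exact mul_le_mul_of_nonneg_left ((hMs x hxW hx.le).trans (le_abs_self _)) (abs_nonneg _)
  have hmain : ∀ h, CrBound W r h M → ContDiff ℝ r (zeroExt W fun x => Φ 0 (τ x) * h x) :=
    fun h hh => contDiff_zeroExt hW.isOpen hτI hτ0 r Φ h hτc
      (fun t ht j hj => (hΦ t ht j hj).1) hflat hh
  refine ⟨W, zeroExt W fun x => Φ 0 (τ x), hW, ?_, ?_, fun x => ?_, fun i => ?_⟩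
  · unfold zeroExt
    fun_prop
  · simpa using hmain (fun _ => 1) (CrBound.const (fun x _ => zero_le_one.trans (hM1 x))
      fun x _ => by simpa using hM1 x)
  · by_cases hx : x ∈ W
    · have := hΦpos _ (hτI x hx)
      simp [zeroExt_of_mem hx, hx, this, this.le]
    · simp [zeroExt_of_notMem hx, hx]
  · convert hmain (g i) (hB i) using 2 with x
    by_cases hx : x ∈ W
    · simp [zeroExt_of_mem hx]
    · simp [zeroExt_of_notMem hx]

end CarvedSets

section Covering

variable {L}

open Matrix (vecCons vecTail vecHead)

theorem hasDerivAt_max_zero_pow (k : ℕ) (x : ℝ) :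
    HasDerivAt (fun x : ℝ => max x 0 ^ (k + 2)) ((k + 2) * max x 0 ^ (k + 1)) x := by
  rcases lt_trichotomy x 0 with h | rfl | h
  · rw [max_eq_right h.le, zero_pow k.succ_ne_zero, mul_zero]
    refine (hasDerivAt_const x (0 : ℝ)).congr_of_eventuallyEq ?_
    filter_upwards [Iio_mem_nhds h] with y hy
    simp [max_eq_right (show y ≤ 0 from hy.le)]
  · rw [hasDerivAt_iff_tendsto_slope]
    have h1 : Filter.Tendsto (fun x : ℝ => max x 0 ^ (k + 1)) (𝓝 0) (𝓝 (max 0 0 ^ (k + 1))) :=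
      (by fun_prop : Continuous fun x : ℝ => max x 0 ^ (k + 1)).tendsto 0
    simp only [max_self, zero_pow k.succ_ne_zero, mul_zero] at h1 ⊢
    refine (h1.mono_left nhdsWithin_le_nhds).congr' ?_
    filter_upwards [self_mem_nhdsWithin] with y hy
    have hy : y ≠ 0 := hy
    rcases lt_or_gt_of_ne hy with h | h
    · simp [slope_def_field, max_eq_right h.le]
    · simp only [slope_def_field, max_eq_left h.le, max_self]
      simp
      field_simp
      ring
  · rw [max_eq_left h.le]
    refine HasDerivAt.congr_of_eventuallyEq ?_ (f := fun y => y ^ (k + 2)) ?_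
    · simpa using hasDerivAt_pow (k + 2) x
    · filter_upwards [Ioi_mem_nhds h] with y hy
      simp [max_eq_left (show 0 ≤ y from hy.le)]

theorem contDiff_max_zero_pow : ∀ r : ℕ, ContDiff ℝ r fun x : ℝ => max x 0 ^ (r + 1)
  | 0 => contDiff_zero.2 (by fun_prop)
  | r + 1 => by
    have h : deriv (fun x : ℝ => max x 0 ^ (r + 2)) = fun x : ℝ => ((r : ℝ) + 2) * max x 0 ^ (r + 1) :=
      funext fun x => (hasDerivAt_max_zero_pow r x).deriv
    rw [Nat.cast_succ, contDiff_succ_iff_deriv, h]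
    exact ⟨fun x => (hasDerivAt_max_zero_pow r x).differentiableAt, by simp,
      contDiff_const.mul (contDiff_max_zero_pow r)⟩

variable (L) in
/-- Some nonnegative definable `C^r` function is supported in `U` and positive on `S`. -/
def Coverable (r : ℕ) {n : ℕ} (U S : Set (Fin n → ℝ)) : Prop :=
  ∃ F : (Fin n → ℝ) → ℝ, Dfn L F ∧ ContDiff ℝ r F ∧
    ∀ x, 0 ≤ F x ∧ (0 < F x → x ∈ U) ∧ (x ∈ S → 0 < F x)

variable {r n : ℕ} {U : Set (Fin n → ℝ)}

theorem Coverable.mono {S S' : Set (Fin n → ℝ)} (hS : S' ⊆ S) : Coverable L r U S → Coverable L r U S'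
  | ⟨F, hd, hc, h⟩ => ⟨F, hd, hc, fun x => ⟨(h x).1, (h x).2.1, fun hx => (h x).2.2 (hS hx)⟩⟩

variable [T : Tame L]

theorem Coverable.iUnion {I : Type} [Fintype I] {S : I → Set (Fin n → ℝ)}
    (h : ∀ i, Coverable L r U (S i)) : Coverable L r U (⋃ i, S i) := by
  choose F hd hc h using h
  have h0 : ∀ x, 0 ≤ ∑ i, F i x := fun x => Finset.sum_nonneg fun i _ => (h i x).1
  refine ⟨fun x => ∑ i, F i x, by fun_prop, ContDiff.sum fun i _ => hc i, fun x => ⟨h0 x, ?_, ?_⟩⟩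
  · intro hx
    obtain ⟨i, -, hi⟩ := Finset.exists_ne_zero_of_sum_ne_zero hx.ne'
    exact (h i x).2.1 (lt_of_le_of_ne (h i x).1 hi.symm)
  · intro hx
    obtain ⟨i, hi⟩ := mem_iUnion.1 hx
    exact ((h i x).2.2 hi).trans_le
      (Finset.single_le_sum (f := fun i => F i x) (fun i _ => (h i x).1) (Finset.mem_univ i))

theorem Coverable.union {S S' : Set (Fin n → ℝ)} (h : Coverable L r U S)
    (h' : Coverable L r U S') : Coverable L r U (S ∪ S') := by
  rw [union_eq_iUnion]
  exact Coverable.iUnion fun b => by cases b <;> assumption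

/-- A definable lower bound for the distance to the complement of `U`. -/
theorem exists_radius {X : Type} [DSpace L X] {p : X → Prop} {h : X → Fin n → ℝ}
    (hU : IsOpen U) (hUd : Dfn L fun x => x ∈ U) (hp : Dfn L p) (hh : Dfn L h)
    (hhU : ∀ z, p z → h z ∈ U) : ∃ θ : X → ℝ, Dfn L θ ∧ (∀ z, 0 ≤ θ z ∧ (p z → 0 < θ z)) ∧
      ∀ z y, (∀ i, |y i - h z i| < θ z) → 0 < θ z → y ∈ U := by
  let Q : X → ℝ → Prop := fun z ρ => p z ∧ 0 ≤ ρ ∧ ρ ≤ 1 ∧ ∀ y, (∀ i, |y i - h z i| < ρ) → y ∈ U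
  have hQd : Dfn L fun q : X × ℝ => Q q.1 q.2 := by
    simp only [Q]
    fun_prop
  have hb : ∀ z, BddAbove {ρ | Q z ρ} := fun z => ⟨1, fun ρ hρ => hρ.2.2.1⟩
  refine ⟨fun z => sSup {ρ | Q z ρ}, by fun_prop, fun z => ⟨Real.sSup_nonneg fun ρ hρ => hρ.2.1,
    fun hz => ?_⟩, fun z y hy hpos => ?_⟩
  · obtain ⟨ρ, hρ, hball⟩ := Metric.isOpen_iff.1 hU _ (hhU z hz)
    have hm : 0 < min ρ 1 := lt_min hρ one_pos
    refine hm.trans_le (le_csSup (hb z) ⟨hz, hm.le, min_le_right _ _, fun y hy => hball ?_⟩)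
    rw [mem_ball_iff_norm]
    refine lt_of_lt_of_le ?_ (min_le_left ρ 1)
    rw [pi_norm_lt_iff hm]
    exact hy
  · simp only at hpos
    have hy' : ‖y - h z‖ < sSup {ρ | Q z ρ} := (pi_norm_lt_iff hpos).2 hy
    have hne : {ρ | Q z ρ}.Nonempty := by
      by_contra hne
      rw [Set.not_nonempty_iff_eq_empty.1 hne, Real.sSup_empty] at hpos
      exact hpos.false
    obtain ⟨ρ, hρ, hlt⟩ := exists_lt_of_lt_csSup hne hy'
    exact hρ.2.2.2 y fun i => (norm_le_pi_norm (y - h z) i).trans_lt hlt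

/-- The part of a graph over a generic set is coverable. -/
theorem coverable_graph {d : ℕ} (hT : OpenCarved L r d) (hU : IsOpen U)
    (hUd : Dfn L fun x => x ∈ U) (σ : Fin d → Fin n) {S : Set (Fin n → ℝ)}
    (hS : Dfn L fun x => x ∈ S) (hSU : S ⊆ U) (hinj : InjOn (fun x => x ∘ σ) S) :
    ∃ W : Set (Fin d → ℝ), Generic L W ∧ Coverable L r U {x | x ∈ S ∧ x ∘ σ ∈ W} := by
  let p : (Fin d → ℝ) → Prop := fun z => ∃ x, x ∈ S ∧ x ∘ σ = z
  have hp : Dfn L p := by fun_prop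
  let h : (Fin d → ℝ) → Fin n → ℝ := fun z i => sSup {t | ∃ x, (x ∈ S ∧ x ∘ σ = z) ∧ x i = t}
  have hhd : Dfn L h := by fun_prop
  have hh : ∀ x ∈ S, h (x ∘ σ) = x := fun x hx => by
    funext i
    have : {t | ∃ y, (y ∈ S ∧ y ∘ σ = x ∘ σ) ∧ y i = t} = {x i} := by
      ext t
      constructor
      · rintro ⟨y, ⟨hy, hyx⟩, rfl⟩
        rw [hinj hy hx hyx]
        rfl
      · rintro rfl
        exact ⟨x, ⟨hx, rfl⟩, rfl⟩
    simp only [h, this, csSup_singleton]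
  obtain ⟨θ, hθd, hθ, hθU⟩ := exists_radius hU hUd hp hhd (by
    rintro z ⟨x, hx, rfl⟩
    rw [hh x hx]
    exact hSU hx)
  obtain ⟨W, μ, hW, hμd, hμc, hμ, hg⟩ := exists_flatMultiplier (r := r) hT
    (g := fun o : Option (Fin n) => o.elim θ fun i z => h z i) (by
      rintro (_ | i) <;> simp only [Option.elim] <;> fun_prop)
  have hσ : ContDiff ℝ r fun x : Fin n → ℝ => x ∘ σ :=
    contDiff_pi.2 fun i => contDiff_apply ℝ ℝ (σ i)
  let Q : (Fin n → ℝ) → ℝ := fun x => (μ (x ∘ σ) * θ (x ∘ σ)) ^ 2 -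
    ∑ i, (μ (x ∘ σ) * x i - μ (x ∘ σ) * h (x ∘ σ) i) ^ 2
  have hQ : ∀ x, Q x = μ (x ∘ σ) ^ 2 * (θ (x ∘ σ) ^ 2 - ∑ i, (x i - h (x ∘ σ) i) ^ 2) := fun x => by
    simp only [Q, ← mul_sub, mul_pow, ← Finset.mul_sum]
  have hQd : Dfn L Q := by fun_prop
  have hQc : ContDiff ℝ r Q := by
    refine (((hg none).comp hσ).pow 2).sub (ContDiff.sum fun i _ => ContDiff.pow ?_ 2)
    exact ((hμc.comp hσ).mul (contDiff_apply ℝ ℝ i)).sub ((hg (some i)).comp hσ)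
  refine ⟨W, hW, fun x => max (Q x) 0 ^ (r + 1), by fun_prop, (contDiff_max_zero_pow r).comp hQc,
    fun x => ⟨by positivity, fun hx => ?_, fun hx => ?_⟩⟩
  · have hQx : 0 < Q x := by
      by_contra hneg
      simp [max_eq_right (not_lt.1 hneg)] at hx
    rw [hQ] at hQx
    have h1 : 0 < θ (x ∘ σ) ^ 2 - ∑ i, (x i - h (x ∘ σ) i) ^ 2 := pos_of_mul_pos_right hQx (sq_nonneg _)
    have h2 : 0 ≤ ∑ i, (x i - h (x ∘ σ) i) ^ 2 := Finset.sum_nonneg fun i _ => sq_nonneg _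
    refine hθU (x ∘ σ) x (fun i => abs_lt_of_sq_lt_sq ?_ (hθ _).1)
      (lt_of_le_of_ne (hθ _).1 fun h0 => ?_)
    · have : (x i - h (x ∘ σ) i) ^ 2 ≤ ∑ i, (x i - h (x ∘ σ) i) ^ 2 :=
        Finset.single_le_sum (f := fun i => (x i - h (x ∘ σ) i) ^ 2) (fun i _ => sq_nonneg _)
          (Finset.mem_univ i)
      linarith
    · rw [← h0] at h1
      linarith
  · have h1 := (hμ (x ∘ σ)).2.2 hx.2
    have h2 := (hθ (x ∘ σ)).2 ⟨x, hx.1, rfl⟩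
    have : 0 < Q x := by
      rw [hQ, hh x hx.1]
      simp only [sub_self]
      simp
      positivity
    positivity

/-- Small definable subsets of an open definable set are coverable. -/
theorem coverable_of_injOn (hT : ∀ d < n, OpenCarved L r d) (hU : IsOpen U)
    (hUd : Dfn L fun x => x ∈ U) (d : ℕ) (hd : d < n) (σ : Fin d → Fin n) {S : Set (Fin n → ℝ)}
    (hS : Dfn L fun x => x ∈ S) (hSU : S ⊆ U) (hinj : InjOn (fun x => x ∘ σ) S) :
    Coverable L r U S := by
  induction d using Nat.strong_induction_on generalizing S with
  | _ d ih =>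
    obtain ⟨W, hW, hcov⟩ := coverable_graph (hT d hd) hU hUd σ hS hSU hinj
    have hWd := hW.dfn
    have := induction_of_interior_empty (L := L) d (fun Z => Coverable L r U {x | x ∈ S ∧ x ∘ σ ∈ Z})
      (fun K Z hZ => (Coverable.iUnion hZ).mono fun x hx => by
        obtain ⟨i, hi⟩ := mem_iUnion.1 hx.2
        exact mem_iUnion.2 ⟨i, hx.1, hi⟩)
      (fun Z hZ d' hd' σ' hinj' => ih d' hd' (hd'.trans hd) (σ ∘ σ') (by
          simp only [Set.mem_ofPred_eq]; fun_prop) (fun x hx => hSU hx.1)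
        fun x hx y hy hxy => hinj hx.1 hy.1 (hinj' hx.2 hy.2 hxy))
      Wᶜ (by simp only [mem_compl_iff]; fun_prop) hW.interior_compl
    exact (hcov.union this).mono fun x hx => by
      by_cases h : x ∘ σ ∈ W
      · exact Or.inl ⟨hx, h⟩
      · exact Or.inr ⟨hx, h⟩

end Covering

section OpenSets

variable {L}
variable [T : Tame L] {r m : ℕ} {U : Set (Fin (m + 1) → ℝ)}

open Matrix (vecCons vecTail vecHead)

/-- Definable families of intervals inside `U` are coverable. -/
theorem coverable_band (hT : ∀ d < m + 1, OpenCarved L r d) (hU : IsOpen U)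
    (hUd : Dfn L fun x => x ∈ U) {α₀ α₁ β₀ β₁ : (Fin m → ℝ) → ℝ} (hα₀ : Dfn L α₀) (hα₁ : Dfn L α₁)
    (hβ₀ : Dfn L β₀) (hβ₁ : Dfn L β₁)
    (hV : ∀ x, 0 < α₀ (vecTail x) + α₁ (vecTail x) * x 0 →
      0 < β₀ (vecTail x) + β₁ (vecTail x) * x 0 → x ∈ U) :
    Coverable L r U {x | 0 < α₀ (vecTail x) + α₁ (vecTail x) * x 0 ∧
      0 < β₀ (vecTail x) + β₁ (vecTail x) * x 0} := by
  set V := {x : Fin (m + 1) → ℝ | 0 < α₀ (vecTail x) + α₁ (vecTail x) * x 0 ∧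
      0 < β₀ (vecTail x) + β₁ (vecTail x) * x 0} with hVdef
  have hVd : Dfn L fun x => x ∈ V := by
    simp only [hVdef, Set.mem_ofPred_eq]
    fun_prop
  obtain ⟨W, μ, hW, hμd, hμc, hμ, hg⟩ := exists_flatMultiplier (r := r) (hT m m.lt_succ_self)
    (g := ![α₀, α₁, β₀, β₁]) (by
      intro i
      fin_cases i <;> assumption)
  have hWd := hW.dfn
  have htail : ContDiff ℝ r (vecTail : (Fin (m + 1) → ℝ) → Fin m → ℝ) :=
    contDiff_pi.2 fun i => contDiff_apply ℝ ℝ i.succ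
  let A : (Fin (m + 1) → ℝ) → ℝ := fun x =>
    μ (vecTail x) * α₀ (vecTail x) + μ (vecTail x) * α₁ (vecTail x) * x 0
  let B : (Fin (m + 1) → ℝ) → ℝ := fun x =>
    μ (vecTail x) * β₀ (vecTail x) + μ (vecTail x) * β₁ (vecTail x) * x 0
  have hA : ContDiff ℝ r A :=
    ((hg 0).comp htail).add (((hg 1).comp htail).mul (contDiff_apply ℝ ℝ 0))
  have hB : ContDiff ℝ r B :=
    ((hg 2).comp htail).add (((hg 3).comp htail).mul (contDiff_apply ℝ ℝ 0))
  have hA' : ∀ x, A x = μ (vecTail x) * (α₀ (vecTail x) + α₁ (vecTail x) * x 0) := fun x => by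
    simp only [A]; ring
  have hB' : ∀ x, B x = μ (vecTail x) * (β₀ (vecTail x) + β₁ (vecTail x) * x 0) := fun x => by
    simp only [B]; ring
  have hpos : ∀ {t : ℝ}, 0 < max t 0 ^ (r + 1) → 0 < t := fun {t} ht => by
    by_contra hneg
    simp [max_eq_right (not_lt.1 hneg)] at ht
  have hcov : Coverable L r U {x | x ∈ V ∧ vecTail x ∈ W} := by
    refine ⟨fun x => max (A x) 0 ^ (r + 1) * max (B x) 0 ^ (r + 1), by fun_prop,
      ((contDiff_max_zero_pow r).comp hA).mul ((contDiff_max_zero_pow r).comp hB),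
      fun x => ⟨by positivity, fun hx => ?_, fun hx => ?_⟩⟩
    · have h1 := hpos (pos_of_mul_pos_left hx (by positivity))
      have h2 := hpos (pos_of_mul_pos_right hx (by positivity))
      rw [hA'] at h1
      rw [hB'] at h2
      exact hV x (pos_of_mul_pos_right h1 (hμ _).1) (pos_of_mul_pos_right h2 (hμ _).1)
    · have h0 := (hμ (vecTail x)).2.2 hx.2
      have h1 : 0 < A x := by rw [hA']; exact mul_pos h0 hx.1.1
      have h2 : 0 < B x := by rw [hB']; exact mul_pos h0 hx.1.2
      positivity
  have := induction_of_interior_empty (L := L) m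
    (fun Z => Coverable L r U {x | x ∈ V ∧ vecTail x ∈ Z})
    (fun K Z hZ => (Coverable.iUnion hZ).mono fun x hx => by
      obtain ⟨i, hi⟩ := mem_iUnion.1 hx.2
      exact mem_iUnion.2 ⟨i, hx.1, hi⟩)
    (fun Z hZ d hd σ hinj => by
      refine coverable_of_injOn hT hU hUd (d + 1) (by lia) (Fin.cons 0 fun i => (σ i).succ)
        (by simp only [Set.mem_ofPred_eq]; fun_prop) (fun x hx => hV x hx.1.1 hx.1.2) ?_
      intro x hx y hy hxy
      have h0 : x 0 = y 0 := congrFun hxy 0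
      have h1 : vecTail x = vecTail y := hinj hx.2 hy.2 (funext fun i => congrFun hxy i.succ)
      funext i
      exact Fin.cases h0 (fun i => congrFun h1 i) i)
    Wᶜ (by simp only [mem_compl_iff]; fun_prop) hW.interior_compl
  exact (hcov.union this).mono fun x hx => by
    by_cases h : vecTail x ∈ W
    · exact Or.inl ⟨hx, h⟩
    · exact Or.inr ⟨hx, h⟩

/-- The boundaries of the fibres of a definable open set are enumerated by finitely many
definable functions. -/
theorem exists_fibre_frontier (hU : IsOpen U) (hUd : Dfn L fun x => x ∈ U) :
    ∃ (K : ℕ) (f : Fin K → (Fin m → ℝ) → ℝ), (∀ i, Dfn L (f i)) ∧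
      ∀ z, (frontier (fibre U z)).Finite ∧ ∀ t ∈ frontier (fibre U z), ∃ i, t = f i z := by
  have hopen : ∀ z, IsOpen (fibre U z) := fun z =>
    hU.preimage (f := fun t => vecCons t z) (by fun_prop)
  have hE : Dfn L fun q : (Fin m → ℝ) × ℝ => q.2 ∈ frontier (fibre U q.1) := by
    simp only [(hopen _).frontier_eq, mem_sdiff, Metric.mem_closure_iff, mem_fibre, Real.dist_eq]
    fun_prop
  have hfin : ∀ z, (frontier (fibre U z)).Finite := fun z => by
    refine finite_of_interior_empty (L := L) ?_ ?_
    · exact hE.comp' (f := fun t : ℝ => (z, t)) (by fun_prop)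
    · rw [← frontier_compl]
      exact interior_frontier (hopen z).isClosed_compl
  obtain ⟨K, hK⟩ := uniformlyFinite_pi m (fun z t => t ∈ frontier (fibre U z)) hE hfin
  obtain ⟨f, hf, hf'⟩ := exists_enumeration K hE hfin hK
  exact ⟨K, f, hf, fun z => ⟨hfin z, hf' z⟩⟩

theorem openCarved_succ (hT : ∀ d < m + 1, OpenCarved L r d) : OpenCarved L r (m + 1) := by
  intro U hU hUd
  obtain ⟨K, f, hf, hfr⟩ := exists_fibre_frontier hU hUd
  have hopen : ∀ z, IsOpen (fibre U z) := fun z =>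
    hU.preimage (f := fun t => vecCons t z) (by fun_prop)
  let a : Option (Fin K) → (Fin m → ℝ) → ℝ → ℝ := fun o z t => o.elim 1 fun i => t - f i z
  let b : Option (Fin K) → (Fin m → ℝ) → ℝ → ℝ := fun o z t => o.elim 1 fun i => f i z - t
  let V : Option (Fin K) → Option (Fin K) → Set (Fin (m + 1) → ℝ) := fun o o' =>
    {x | (0 < a o (vecTail x) (x 0) ∧ 0 < b o' (vecTail x) (x 0)) ∧
      ∀ t, 0 < a o (vecTail x) t → 0 < b o' (vecTail x) t → vecCons t (vecTail x) ∈ U}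
  have hV : ∀ o o', Coverable L r U (V o o') := by
    classical
    intro o o'
    let χ : (Fin m → ℝ) → ℝ := fun z =>
      if ∀ t, 0 < a o z t → 0 < b o' z t → vecCons t z ∈ U then 1 else 0
    have hα : Dfn L fun q : (Fin m → ℝ) × ℝ => a o q.1 q.2 := by
      rcases o with _ | i <;> simp only [a, Option.elim] <;> fun_prop
    have hβ : Dfn L fun q : (Fin m → ℝ) × ℝ => b o' q.1 q.2 := by
      rcases o' with _ | i <;> simp only [b, Option.elim] <;> fun_prop
    have hχd : Dfn L χ := by
      simp only [χ]
      fun_prop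
    have ha : ∀ z t, a o z t = a o z 0 + (a o z 1 - a o z 0) * t := fun z t => by
      rcases o with _ | i <;> simp [a]; ring
    have hb : ∀ z t, b o' z t = b o' z 0 + (b o' z 1 - b o' z 0) * t := fun z t => by
      rcases o' with _ | i <;> simp [b]; ring
    have ha' : ∀ z t, χ z * a o z 0 + χ z * (a o z 1 - a o z 0) * t = χ z * a o z t :=
      fun z t => by rw [ha z t]; ring
    have hb' : ∀ z t, χ z * b o' z 0 + χ z * (b o' z 1 - b o' z 0) * t = χ z * b o' z t :=
      fun z t => by rw [hb z t]; ring
    have := coverable_band hT hU hUd (α₀ := fun z => χ z * a o z 0)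
      (α₁ := fun z => χ z * (a o z 1 - a o z 0)) (β₀ := fun z => χ z * b o' z 0)
      (β₁ := fun z => χ z * (b o' z 1 - b o' z 0)) (by fun_prop) (by fun_prop) (by fun_prop)
      (by fun_prop) (fun x h1 h2 => by
        rw [ha'] at h1
        rw [hb'] at h2
        by_cases hx : ∀ t, 0 < a o (vecTail x) t → 0 < b o' (vecTail x) t →
            vecCons t (vecTail x) ∈ U
        · simp only [χ, if_pos hx, one_mul] at h1 h2
          exact Matrix.cons_head_tail x ▸ hx _ h1 h2
        · simp [χ, if_neg hx] at h1)
    refine this.mono fun x hx => ?_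
    simp only [Set.mem_ofPred_eq, ha', hb']
    have hχ : χ (vecTail x) = 1 := if_pos hx.2
    rw [hχ, one_mul, one_mul]
    exact hx.1
  have hcov : Coverable L r U (⋃ p : Option (Fin K) × Option (Fin K), V p.1 p.2) :=
    Coverable.iUnion fun p => hV p.1 p.2
  obtain ⟨F, hFd, hFc, hF⟩ := hcov
  refine ⟨F, hFd, hFc, fun x => ⟨(hF x).1, (hF x).2.1, fun hx => (hF x).2.2 (mem_iUnion.2 ?_)⟩⟩
  obtain ⟨hfin, hen⟩ := hfr (vecTail x)
  have hx' : x 0 ∈ fibre U (vecTail x) := by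
    rw [mem_fibre]
    exact (Matrix.cons_head_tail x).symm ▸ hx
  have hnot : x 0 ∉ frontier (fibre U (vecTail x)) := fun h => by
    rw [(hopen _).frontier_eq] at h
    exact h.2 hx'
  obtain ⟨o, ho, ho'⟩ : ∃ o, 0 < a o (vecTail x) (x 0) ∧
      ∀ p ∈ frontier (fibre U (vecTail x)), 0 < a o (vecTail x) p → x 0 < p := by
    rcases exists_lower hfin hen hnot with ⟨i, -, hi, hi'⟩ | h
    · exact ⟨some i, sub_pos.2 hi, fun p hp h => hi' p hp (sub_pos.1 h)⟩
    · exact ⟨none, one_pos, fun p hp _ => h p hp⟩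
  obtain ⟨o', hu, hu'⟩ : ∃ o, 0 < b o (vecTail x) (x 0) ∧
      ∀ p ∈ frontier (fibre U (vecTail x)), 0 < b o (vecTail x) p → p < x 0 := by
    rcases exists_upper hfin hen hnot with ⟨i, -, hi, hi'⟩ | h
    · exact ⟨some i, sub_pos.2 hi, fun p hp h => hi' p hp (sub_pos.1 h)⟩
    · exact ⟨none, one_pos, fun p hp _ => h p hp⟩
  have hconn : OrdConnected {t | 0 < a o (vecTail x) t ∧ 0 < b o' (vecTail x) t} := by
    refine ⟨fun s hs t ht u hu => ⟨?_, ?_⟩⟩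
    · have := hs.1
      have := hu.1
      rcases o with _ | i <;> simp only [a, Option.elim] at * <;> linarith
    · have := ht.2
      have := hu.2
      rcases o' with _ | i <;> simp only [b, Option.elim] at * <;> linarith
  have hsub := hconn.isPreconnected.subset_of_closure_inter_subset (hopen (vecTail x))
    ⟨x 0, ⟨ho, hu⟩, hx'⟩ (by
      rintro t ⟨ht, hta, htb⟩
      by_contra hne
      have hfr : t ∈ frontier (fibre U (vecTail x)) := by
        rw [(hopen _).frontier_eq]
        exact ⟨ht, hne⟩
      exact lt_asymm (ho' t hfr hta) (hu' t hfr htb))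
  exact ⟨(o, o'), ⟨ho, hu⟩, fun t h1 h2 => hsub ⟨h1, h2⟩⟩

/-- Definable open sets are positivity sets of definable `C^r` functions. -/
theorem openCarved (r n : ℕ) : OpenCarved L r n := by
  induction n using Nat.strong_induction_on with
  | _ n ih =>
    cases n with
    | succ m => exact openCarved_succ ih
    | zero =>
      classical
      intro U _ hUd
      refine ⟨fun x => if x ∈ U then 1 else 0, by fun_prop, ?_, fun x => ?_⟩
      · have : (fun x : Fin 0 → ℝ => if x ∈ U then (1 : ℝ) else 0) =
            fun _ => if (0 : Fin 0 → ℝ) ∈ U then (1 : ℝ) else 0 :=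
          funext fun x => by rw [Subsingleton.elim x 0]
        rw [this]
        exact contDiff_const
      · by_cases hx : x ∈ U <;> simp [hx]

end OpenSets

section Separation

variable {L}

theorem closure_inter_eq {n : ℕ} {M X : Set (Fin n → ℝ)} (h : ∃ C, IsClosed C ∧ X = M ∩ C) :
    ∀ x ∈ M, x ∈ closure X ↔ x ∈ X := by
  obtain ⟨C, hC, rfl⟩ := h
  exact fun x hx => ⟨fun hc => ⟨hx, closure_minimal inter_subset_right hC hc⟩,
    fun h => subset_closure h⟩

theorem exists_zeroSet [T : Tame L] (r : ℕ) {n : ℕ} {M X : Set (Fin n → ℝ)}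
    (hX : Def L n X) (h : ∃ C, IsClosed C ∧ X = M ∩ C) :
    ∃ F : (Fin n → ℝ) → ℝ, Dfn L F ∧ ContDiff ℝ r F ∧ (∀ x, 0 ≤ F x) ∧
      ∀ x ∈ M, F x = 0 ↔ x ∈ X := by
  have hXd : Dfn L fun x => x ∈ closure X := dfn_closure (dfn_iff_def.2 hX)
  obtain ⟨F, hF, hFc, hF'⟩ := openCarved (L := L) r n (closure X)ᶜ isClosed_closure.isOpen_compl
    (by simp only [mem_compl_iff]; fun_prop)
  refine ⟨F, hF, hFc, fun x => (hF' x).1, fun x hx => ?_⟩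
  rw [← closure_inter_eq h x hx, ← not_iff_not, ← mem_compl_iff, ← (hF' x).2,
    (hF' x).1.lt_iff_ne, ne_comm]

end Separation

/-- definable `C^r` separation of disjoint definable closed subsets of a
definable `C^r` submanifold. -/
theorem statement11
    (hfield : ExpandsOrderedField L) (hlom : LocallyOMinimal L)
    (r n d : ℕ) (M : Set (Fin n → ℝ)) (hM : IsDefCrSubmanifold L r n d M)
    (X Y : Set (Fin n → ℝ)) (hXdef : Def L n X) (hYdef : Def L n Y)
    (hXM : X ⊆ M) (hYM : Y ⊆ M)
    (hXclosed : ∃ C, IsClosed C ∧ X = M ∩ C)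
    (hYclosed : ∃ C, IsClosed C ∧ Y = M ∩ C)
    (hXY : X ∩ Y = ∅) :
    ∃ f : (Fin n → ℝ) → ℝ, DefCrFunOn L r n M f ∧
      (∀ x ∈ M, f x ∈ Set.Icc (0 : ℝ) 1) ∧
      {x ∈ M | f x = 0} = X ∧ {x ∈ M | f x = 1} = Y := by
  have : Tame L := ⟨hfield, hlom⟩
  obtain ⟨F, hFd, hFc, hF0, hF⟩ := exists_zeroSet r hXdef hXclosed
  obtain ⟨G, hGd, hGc, hG0, hG⟩ := exists_zeroSet r hYdef hYclosed
  have hpos : ∀ x ∈ M, 0 < F x + G x := fun x hx => by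
    refine lt_of_le_of_ne (add_nonneg (hF0 x) (hG0 x)) fun h => ?_
    have h1 : F x = 0 := by linarith [hF0 x, hG0 x]
    have h2 : G x = 0 := by linarith [hF0 x, hG0 x]
    exact hXY.le ⟨(hF x hx).1 h1, (hG x hx).1 h2⟩
  have hMd : Dfn L fun x => x ∈ M := dfn_iff_def.2 hM.1
  refine ⟨fun x => F x / (F x + G x), ⟨?_, fun a ha => ?_⟩, fun x hx => ?_, ?_, ?_⟩
  · refine dfn_iff_def.1 ?_
    unfold fstFun sndFun
    fun_prop
  · refine ⟨{x | 0 < F x + G x}, fun x => F x / (F x + G x), hpos a ha,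
      isOpen_lt continuous_const (hFc.continuous.add hGc.continuous), ?_, fun x _ => rfl⟩
    exact hFc.contDiffOn.div (hFc.add hGc).contDiffOn fun x hx => (show 0 < F x + G x from hx).ne'
  · exact ⟨div_nonneg (hF0 x) (hpos x hx).le, (div_le_one (hpos x hx)).2 (by linarith [hG0 x])⟩
  · ext x
    refine ⟨fun ⟨hx, h⟩ => (hF x hx).1 ?_, fun hx => ⟨hXM hx, ?_⟩⟩
    · exact (div_eq_zero_iff.1 h).resolve_right (hpos x hx).ne'
    · simp [(hF x (hXM hx)).2 hx]
  · ext x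
    refine ⟨fun ⟨hx, h⟩ => (hG x hx).1 ?_, fun hx => ⟨hYM hx, ?_⟩⟩
    · have := (div_eq_one_iff_eq (hpos x hx).ne').1 h
      linarith
    · rw [div_eq_one_iff_eq (hpos x (hYM hx)).ne', (hG x (hYM hx)).2 hx, add_zero]

end Paper
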